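/- arXiv:0904.1332 — 6 statements merged into one kernel-verified Lean document; each statement's English description precedes it below -/
import Mathlib

section
/- Let Ω ⊆ ℝⁿ be a bounded convex open set and let 1 < p < ∞. Then for every smooth function ζ with compact support in Ω, ∫_Ω |ζ(x)/δ(x)|^p dx ≤ (p/(p−1))^p ∫_Ω |∇ζ(x)|^p dx, where δ(x) = dist(x, ∂Ω) is the distance from x to the boundary of Ω. -/
open MeasureTheory Metric Set

lemma hc_translate {n : ℕ} (G : EuclideanSpace ℝ (Fin n) → ℝ) (hG : ContDiff ℝ 1 G)
    (hGc : HasCompactSupport G) (hG0 : ∀ x, 0 ≤ G x) (C : Set (EuclideanSpace ℝ (Fin n)))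
    (hCm : MeasurableSet C) (u : EuclideanSpace ℝ (Fin n))
    (hC : ∀ x ∈ C, ∀ s : ℝ, 0 ≤ s → x - s • u ∈ C) :
    0 ≤ ∫ x in C, fderiv ℝ G x u := by
  obtain ⟨L, hL⟩ := hG.lipschitzWith_of_hasCompactSupport hGc (by norm_num)
  have hGi : Integrable G := hG.continuous.integrable_of_hasCompactSupport hGc
  set B := tsupport G with hB
  have hBm : MeasurableSet B := (isClosed_tsupport G).measurableSet
  have hgi : Integrable ((C ∩ B).indicator (fun _ => (1 : ℝ))) := by
    rw [integrable_indicator_iff (hCm.inter hBm)]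
    apply integrableOn_const
    · exact ((measure_mono inter_subset_right).trans_lt hGc.isCompact.measure_lt_top).ne
    · simp
  have key := hL.integral_inv_smul_sub_mul_tendsto_integral_lineDeriv_mul
    (μ := volume) hgi (-u)
  have e : ∀ F : EuclideanSpace ℝ (Fin n) → ℝ, ∫ x, F x * (C ∩ B).indicator (fun _ => (1 : ℝ)) x
      = ∫ x in C ∩ B, F x := by
    intro F
    rw [← integral_indicator (hCm.inter hBm)]
    congr 1; ext x
    by_cases hx : x ∈ C ∩ B <;> simp [hx]
  have e2 : ∀ F : EuclideanSpace ℝ (Fin n) → ℝ, (∀ x, x ∉ B → F x = 0) →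
      ∫ x in C ∩ B, F x = ∫ x in C, F x := by
    intro F hF
    rw [← setIntegral_indicator hBm]
    congr 1; ext x
    by_cases hx : x ∈ B <;> simp [hx, hF]
  have hlim : ∫ x, lineDeriv ℝ G x (-u) * (C ∩ B).indicator (fun _ => (1 : ℝ)) x
      = - ∫ x in C, fderiv ℝ G x u := by
    rw [e, ← integral_neg, ← e2]
    · congr 1; ext x
      rw [((hG.differentiable (by norm_num)) x).lineDeriv_eq_fderiv, map_neg]
    · intro x hx
      rw [fderiv_of_notMem_tsupport ℝ hx]; simp
  rw [hlim] at key
  have : - ∫ x in C, fderiv ℝ G x u ≤ 0 := by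
    refine le_of_tendsto key ?_
    filter_upwards [self_mem_nhdsWithin] with t ht
    rw [e]
    have ht : 0 < t := ht
    have hGt : Integrable (fun x => G (x + t • -u)) := hGi.comp_add_right _
    simp only [smul_eq_mul]
    rw [integral_const_mul, integral_sub hGt.integrableOn hGi.integrableOn]
    apply mul_nonpos_of_nonneg_of_nonpos (by positivity)
    rw [sub_nonpos, e2 G (fun x hx => image_eq_zero_of_notMem_tsupport hx)]
    calc ∫ x in C ∩ B, G (x + t • -u) ≤ ∫ x in C, G (x + t • -u) :=
          setIntegral_mono_set hGt.integrableOn (.of_forall fun x => hG0 _)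
            (inter_subset_left.eventuallyLE)
      _ = ∫ x, (fun y => C.indicator (fun _ => (1 : ℝ)) (y + t • u) * G y) (x + t • -u) := by
          rw [← integral_indicator hCm]
          congr 1; ext x
          by_cases hx : x ∈ C <;> simp [hx]
      _ = ∫ y, C.indicator (fun _ => (1 : ℝ)) (y + t • u) * G y :=
          integral_add_right_eq_self
            (fun y => C.indicator (fun _ => (1 : ℝ)) (y + t • u) * G y) (t • -u)
      _ ≤ ∫ y, C.indicator G y := by
          apply integral_mono_of_nonneg
          · refine .of_forall fun y => mul_nonneg (indicator_nonneg (by simp) _) (hG0 _)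
          · exact hGi.indicator hCm
          · refine .of_forall fun y => ?_
            by_cases hy : y + t • u ∈ C
            · have := hC _ hy t ht.le
              simp at this
              simp [hy, this]
            · simp only [hy, not_false_eq_true, indicator_of_notMem, zero_mul]
              exact indicator_nonneg (fun x _ => hG0 x) _
      _ = ∫ x in C, G x := integral_indicator hCm
  linarith

lemma hc_young (p : ℝ) (hp : 1 < p) (a b : ℝ) (ha : 0 ≤ a) (hb : 0 ≤ b) :
    p / (p - 1) * (p * a ^ (p - 1) * b - (p - 1) * a ^ p) ≤ (p / (p - 1)) ^ p * b ^ p - a ^ p := by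
  have hp1 : 0 < p - 1 := by linarith
  have h := Real.young_inequality_of_nonneg (a := p / (p - 1) * b) (b := a ^ (p - 1)) (p := p)
    (q := p / (p - 1)) (by positivity) (by positivity) (Real.HolderConjugate.conjExponent hp)
  rw [← Real.rpow_mul ha, Real.mul_rpow (by positivity) hb,
    show (p - 1) * (p / (p - 1)) = p by field_simp] at h
  have h2 := mul_le_mul_of_nonneg_left h (by linarith : 0 ≤ p)
  have e1 : p * ((p / (p - 1)) ^ p * b ^ p / p + a ^ p / (p / (p - 1)))
    = (p / (p - 1)) ^ p * b ^ p + (p - 1) * a ^ p := by field_simp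
  have e2 : p / (p - 1) * ((p - 1) * a ^ p) = p * a ^ p := by field_simp
  rw [e1] at h2
  rw [mul_sub, e2]
  linarith

lemma hc_cell {n : ℕ} (p : ℝ) (hp : 1 < p) (ζ : EuclideanSpace ℝ (Fin n) → ℝ)
    (hζ : ContDiff ℝ 1 ζ) (hζc : HasCompactSupport ζ) (C : Set (EuclideanSpace ℝ (Fin n)))
    (hCm : MeasurableSet C) (u : EuclideanSpace ℝ (Fin n)) (hu : ‖u‖ = 1) (c : ℝ)
    (hC : ∀ x ∈ C, ∀ s : ℝ, 0 ≤ s → x - s • u ∈ C)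
    (hd : ∀ x ∈ tsupport ζ, 0 < c + inner ℝ u x) :
    Integrable (fun x => |ζ x / (c + inner ℝ u x)| ^ p) ∧
    ∫ x in C, |ζ x / (c + inner ℝ u x)| ^ p ≤ (p / (p - 1)) ^ p * ∫ x in C, ‖gradient ζ x‖ ^ p := by
  set d : EuclideanSpace ℝ (Fin n) → ℝ := fun x => c + inner ℝ u x with hdd
  have hds : ContDiff ℝ 1 d := contDiff_const.add (innerSL ℝ u).contDiff
  set φ : EuclideanSpace ℝ (Fin n) → ℝ := fun x => ζ x / d x with hφd
  have hz : ∀ x, x ∉ tsupport ζ → φ x = 0 := fun x hx => by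
    simp [hφd, image_eq_zero_of_notMem_tsupport hx]
  have hφ : ContDiff ℝ 1 φ := by
    rw [contDiff_iff_contDiffAt]
    intro x
    by_cases hx : x ∈ tsupport ζ
    · exact hζ.contDiffAt.div hds.contDiffAt (hd x hx).ne'
    · have : φ =ᶠ[nhds x] fun _ => 0 := by
        filter_upwards [(isClosed_tsupport ζ).isOpen_compl.mem_nhds hx] with y hy using hz y hy
      exact contDiffAt_const.congr_of_eventuallyEq this
  have hφc : HasCompactSupport φ := HasCompactSupport.intro hζc.isCompact (fun x hx => hz x hx)
  have hpow : ContDiff ℝ 1 (fun x => |φ x| ^ p) := by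
    simpa using hφ.norm_rpow hp
  have hpowc : HasCompactSupport (fun x => |φ x| ^ p) :=
    hφc.comp_left (g := fun y => |y| ^ p) (by simp [(by linarith : p ≠ 0)])
  have hint : Integrable (fun x => |φ x| ^ p) :=
    hpow.continuous.integrable_of_hasCompactSupport hpowc
  refine ⟨hint, ?_⟩
  have hGn : ∀ x, 0 ≤ |φ x| ^ p * d x := by
    intro x
    by_cases hx : x ∈ tsupport ζ
    · have := hd x hx
      positivity
    · rw [hz x hx, abs_zero, Real.zero_rpow (by linarith), zero_mul]
  have hG : ContDiff ℝ 1 (fun x => |φ x| ^ p * d x) := hpow.mul hds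
  have hGc : HasCompactSupport (fun x => |φ x| ^ p * d x) := hpowc.mul_right
  have T := hc_translate _ hG hGc hGn C hCm u hC
  have hgi : Integrable (fun x => ‖gradient ζ x‖ ^ p) := by
    have : (fun x => ‖gradient ζ x‖ ^ p) = fun x => ‖fderiv ℝ ζ x‖ ^ p := by
      ext x; simp [gradient]
    rw [this]
    apply Continuous.integrable_of_hasCompactSupport
    · exact (hζ.continuous_fderiv (by norm_num)).norm.rpow_const (fun x => Or.inr (by linarith))
    · exact (hζc.fderiv ℝ).comp_left (g := fun y => ‖y‖ ^ p) (by simp [(by linarith : p ≠ 0)])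
  have hpt : ∀ x, p / (p - 1) * fderiv ℝ (fun x => |φ x| ^ p * d x) x u ≤
      (p / (p - 1)) ^ p * ‖gradient ζ x‖ ^ p - |φ x| ^ p := by
    intro x
    have hφx : HasFDerivAt φ (fderiv ℝ φ x) x :=
      (hφ.differentiable (by norm_num) x).hasFDerivAt
    have hdx : HasFDerivAt d (innerSL ℝ u) x := by
      exact ((innerSL ℝ u).hasFDerivAt (x := x)).const_add c
    have hζφ : ζ = fun x => φ x * d x := by
      ext y
      by_cases hy : y ∈ tsupport ζ
      · exact (div_mul_cancel₀ _ (hd y hy).ne').symm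
      · simp [hz y hy, image_eq_zero_of_notMem_tsupport hy]
    have h1 : fderiv ℝ ζ x u = φ x + d x * fderiv ℝ φ x u := by
      conv_lhs => rw [hζφ]
      rw [(hφx.fun_mul hdx).fderiv]
      simp [hu]
    have h2 : fderiv ℝ (fun x => |φ x| ^ p * d x) x u
        = |φ x| ^ p + d x * ((p * |φ x| ^ (p - 2) * φ x) * fderiv ℝ φ x u) := by
      have := ((hasDerivAt_abs_rpow (φ x) hp).comp_hasFDerivAt x hφx).fun_mul hdx
      have := this.fderiv
      simp only [Function.comp_def] at this
      rw [this]
      simp [hu]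
    have h3 : |fderiv ℝ ζ x u| ≤ ‖gradient ζ x‖ := by
      have := (fderiv ℝ ζ x).le_opNorm u
      simpa [gradient, hu] using this
    have h4 : |φ x| ^ (p - 2) * φ x * φ x = |φ x| ^ p := by
      by_cases h0 : φ x = 0
      · simp [h0, (by linarith : p ≠ 0)]
      · have : 0 < |φ x| := abs_pos.2 h0
        rw [mul_assoc, ← abs_mul_abs_self, ← mul_assoc, ← Real.rpow_add_one this.ne',
          ← Real.rpow_add_one this.ne']
        congr 1; ring
    have h5 : |φ x| ^ (p - 2) * φ x * fderiv ℝ ζ x u ≤ |φ x| ^ (p - 1) * ‖gradient ζ x‖ := by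
      refine (le_abs_self _).trans ?_
      rw [abs_mul]
      have : |(|φ x| ^ (p - 2) * φ x)| = |φ x| ^ (p - 1) := by
        by_cases h0 : φ x = 0
        · simp [h0, (by linarith : p - 1 ≠ 0)]
        · have : 0 < |φ x| := abs_pos.2 h0
          rw [abs_mul, abs_of_nonneg (by positivity : 0 ≤ |φ x| ^ (p - 2)),
            ← Real.rpow_add_one this.ne']
          congr 1; ring
      rw [this]
      gcongr
    have h6 : fderiv ℝ (fun x => |φ x| ^ p * d x) x u ≤
        p * |φ x| ^ (p - 1) * ‖gradient ζ x‖ - (p - 1) * |φ x| ^ p := by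
      have : fderiv ℝ (fun x => |φ x| ^ p * d x) x u
        = p * (|φ x| ^ (p - 2) * φ x * fderiv ℝ ζ x u) - (p - 1) * |φ x| ^ p := by
        rw [h2, h1]
        linear_combination (-p) * h4
      rw [this]
      have := mul_le_mul_of_nonneg_left h5 (by linarith : 0 ≤ p)
      linarith
    refine le_trans (mul_le_mul_of_nonneg_left h6 ?_)
      (hc_young p hp |φ x| ‖gradient ζ x‖ (abs_nonneg _) (norm_nonneg _))
    apply div_nonneg <;> linarith
  have hfi : Integrable (fun x => fderiv ℝ (fun x => |φ x| ^ p * d x) x u) := by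
    apply Continuous.integrable_of_hasCompactSupport
    · exact (hG.continuous_fderiv (by norm_num)).clm_apply continuous_const
    · exact (hGc.fderiv ℝ).comp_left (g := fun y => y u) (by simp)
  have M := setIntegral_mono (s := C) (hfi.const_mul (p / (p - 1))).integrableOn
    ((hgi.const_mul ((p / (p - 1)) ^ p)).sub hint).integrableOn hpt
  simp only [Pi.sub_apply] at M
  rw [integral_const_mul, integral_sub (hgi.const_mul _).integrableOn hint.integrableOn,
    integral_const_mul] at M
  have : 0 ≤ p / (p - 1) := by apply div_nonneg <;> linarith
  have := mul_nonneg this T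
  linarith

lemma hc_halfspace {n : ℕ} (Ω : Set (EuclideanSpace ℝ (Fin n))) (hΩo : IsOpen Ω)
    (hΩconv : Convex ℝ Ω) (hΩb : Bornology.IsBounded Ω) (hne : (frontier Ω).Nonempty)
    (x : EuclideanSpace ℝ (Fin n)) (hx : x ∈ Ω) :
    ∃ (u : EuclideanSpace ℝ (Fin n)) (c : ℝ), ‖u‖ = 1 ∧ (∀ y ∈ Ω, 0 < c + inner ℝ u y) ∧
      c + inner ℝ u x ≤ infDist x (frontier Ω) := by
  have hcomp : IsCompact (frontier Ω) :=
    Metric.isCompact_of_isClosed_isBounded isClosed_frontier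
      (hΩb.closure.subset frontier_subset_closure)
  obtain ⟨z, hz, hzd⟩ := hcomp.exists_infDist_eq_dist hne x
  have hzΩ : z ∉ Ω := fun h => by
    rw [hΩo.frontier_eq] at hz
    exact hz.2 h
  obtain ⟨f, hf⟩ := geometric_hahn_banach_open_point hΩconv hΩo hzΩ
  set w := (InnerProductSpace.toDual ℝ (EuclideanSpace ℝ (Fin n))).symm f with hw
  have hfw : ∀ y, f y = inner ℝ w y := fun y => by
    simp [hw]
  have hw0 : w ≠ 0 := by
    intro h
    have := hf x hx
    simp [hfw, h] at this
  have hwn : 0 < ‖w‖ := norm_pos_iff.2 hw0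
  refine ⟨-(‖w‖⁻¹ • w), ‖w‖⁻¹ * f z, ?_, ?_, ?_⟩
  · rw [norm_neg, norm_smul, norm_inv, norm_norm, inv_mul_cancel₀ hwn.ne']
  · intro y hy
    rw [inner_neg_left, real_inner_smul_left, ← hfw, ← sub_eq_add_neg, ← mul_sub]
    have := hf y hy
    have : 0 < f z - f y := by linarith
    positivity
  · rw [inner_neg_left, real_inner_smul_left, hfw, ← sub_eq_add_neg, ← mul_sub, ← inner_sub_right,
      hzd, dist_comm, dist_eq_norm]
    have := real_inner_le_norm w (z - x)
    rw [inv_mul_le_iff₀ hwn]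
    exact this

lemma hc_argmin {N : ℕ} (f : Fin N → ℝ) (i₀ : Fin N) :
    ∃ i, (∀ j, f i ≤ f j) ∧ ∀ j < i, f i < f j := by
  obtain ⟨k, -, hk⟩ := Finset.exists_min_image Finset.univ f ⟨i₀, Finset.mem_univ _⟩
  obtain ⟨i, hi, hmin⟩ := WellFounded.has_min (wellFounded_lt (α := Fin N))
    {i | ∀ j, f i ≤ f j} ⟨k, fun j => hk j (Finset.mem_univ _)⟩
  refine ⟨i, hi, fun j hj => ?_⟩
  by_contra h
  push Not at h
  exact hmin j (fun l => h.trans (hi l)) hj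

lemma hc_eps
    (n : ℕ) (p : ℝ) (hp : 1 < p)
    (Ω : Set (EuclideanSpace ℝ (Fin n))) (hΩo : IsOpen Ω)
    (hΩconv : Convex ℝ Ω) (hΩb : Bornology.IsBounded Ω) (hne : (frontier Ω).Nonempty)
    (ζ : EuclideanSpace ℝ (Fin n) → ℝ)
    (hζ : ContDiff ℝ 1 ζ) (hζc : HasCompactSupport ζ) (hζs : tsupport ζ ⊆ Ω)
    (ε : ℝ) (hε : 0 < ε) :
    ∫ x, |ζ x / Metric.infDist x (frontier Ω)| ^ p
      ≤ (1 + ε) ^ p * ((p / (p - 1)) ^ p * ∫ x, ‖gradient ζ x‖ ^ p) := by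
  have hδ : ∀ x ∈ Ω, 0 < infDist x (frontier Ω) := fun x hx => by
    rw [← isClosed_frontier.notMem_iff_infDist_pos hne, hΩo.frontier_eq]
    exact fun h => h.2 hx
  choose! u c hu hpos hle using hc_halfspace Ω hΩo hΩconv hΩb hne
  obtain ⟨t, htK, htc⟩ := hζc.isCompact.elim_nhds_subcover
    (fun x => {y | c x + inner ℝ (u x) y < (1 + ε) * infDist y (frontier Ω)}) (by
      intro x hx
      apply IsOpen.mem_nhds
      · apply isOpen_lt
        · exact continuous_const.add (innerSL ℝ (u x)).continuous
        · exact continuous_const.mul (continuous_infDist_pt _)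
      · have h1 := hle x (hζs hx)
        have h2 := hδ x (hζs hx)
        show c x + inner ℝ (u x) x < (1 + ε) * infDist x (frontier Ω)
        nlinarith)
  let N := t.card
  let e : Fin N ≃ t := t.equivFin.symm
  let d : Fin N → EuclideanSpace ℝ (Fin n) → ℝ := fun i y =>
    c (e i) + inner ℝ (u (e i)) y
  have hdc : ∀ i, Continuous (d i) := fun i =>
    continuous_const.add (innerSL ℝ (u (e i))).continuous
  have heΩ : ∀ i, (e i : EuclideanSpace ℝ (Fin n)) ∈ Ω := fun i => hζs (htK _ (e i).2)
  let C : Fin N → Set (EuclideanSpace ℝ (Fin n)) := fun i =>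
    {x | (∀ j, d i x ≤ d j x) ∧ ∀ j < i, d i x < d j x}
  have hCm : ∀ i, MeasurableSet (C i) := by
    intro i
    have : C i = (⋂ j, {x | d i x ≤ d j x}) ∩ ⋂ j, ⋂ (_ : j < i), {x | d i x < d j x} := by
      ext x; simp [C]
    rw [this]
    refine (MeasurableSet.iInter fun j => ?_).inter
      (MeasurableSet.iInter fun j => MeasurableSet.iInter fun _ => ?_)
    · exact measurableSet_le (hdc i).measurable (hdc j).measurable
    · exact measurableSet_lt (hdc i).measurable (hdc j).measurable
  have hCt : ∀ i, ∀ x ∈ C i, ∀ s : ℝ, 0 ≤ s → x - s • u (e i) ∈ C i := by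
    intro i x hx s hs
    have hdi : ∀ j, d i (x - s • u (e i)) - d i x ≤ d j (x - s • u (e i)) - d j x := by
      intro j
      simp only [d, inner_sub_right, real_inner_smul_right]
      have h1 : inner ℝ (u (e i)) (u (e i)) = (1 : ℝ) := by
        rw [real_inner_self_eq_norm_sq, hu _ (heΩ i)]; norm_num
      have h2 : inner ℝ (u (e j)) (u (e i)) ≤ (1 : ℝ) := by
        have := real_inner_le_norm (u (e j)) (u (e i))
        rwa [hu _ (heΩ i), hu _ (heΩ j), one_mul] at this
      rw [h1]
      nlinarith
    exact ⟨fun j => by linarith [hdi j, hx.1 j], fun j hj => by linarith [hdi j, hx.2 j hj]⟩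
  have hcell := fun i => hc_cell p hp ζ hζ hζc (C i) (hCm i) (u (e i)) (hu _ (heΩ i)) (c (e i))
    (hCt i) (fun x hx => hpos _ (heΩ i) x (hζs hx))
  have hgi : Integrable (fun x => ‖gradient ζ x‖ ^ p) := by
    have : (fun x => ‖gradient ζ x‖ ^ p) = fun x => ‖fderiv ℝ ζ x‖ ^ p := by
      ext x; simp [gradient]
    rw [this]
    apply Continuous.integrable_of_hasCompactSupport
    · exact (hζ.continuous_fderiv (by norm_num)).norm.rpow_const (fun x => Or.inr (by linarith))
    · exact (hζc.fderiv ℝ).comp_left (g := fun y => ‖y‖ ^ p) (by simp [(by linarith : p ≠ 0)])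
  have hpt : ∀ x, |ζ x / infDist x (frontier Ω)| ^ p ≤
      (1 + ε) ^ p * ∑ i, (C i).indicator (fun x => |ζ x / d i x| ^ p) x := by
    intro x
    have hnn : ∀ i, 0 ≤ (C i).indicator (fun x => |ζ x / d i x| ^ p) x := fun i =>
      indicator_nonneg (fun y _ => by positivity) _
    by_cases hx : x ∈ tsupport ζ
    · obtain ⟨y, hyt, hy⟩ := mem_iUnion₂.1 (htc hx)
      obtain ⟨i, hi⟩ := hc_argmin (fun i => d i x) (e.symm ⟨y, hyt⟩)
      have h1 : d i x < (1 + ε) * infDist x (frontier Ω) := by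
        refine (hi.1 (e.symm ⟨y, hyt⟩)).trans_lt ?_
        simpa [d] using hy
      have h0 : 0 < d i x := hpos _ (heΩ i) x (hζs hx)
      have hd0 := hδ x (hζs hx)
      have h2 : (C i).indicator (fun x => |ζ x / d i x| ^ p) x = |ζ x / d i x| ^ p :=
        indicator_of_mem (show x ∈ C i from hi) _
      have h3 := Finset.single_le_sum (fun j _ => hnn j) (Finset.mem_univ i)
      rw [h2] at h3
      refine le_trans ?_ (mul_le_mul_of_nonneg_left h3 (by positivity))
      rw [← Real.mul_rpow (by positivity) (by positivity)]
      apply Real.rpow_le_rpow (by positivity) _ (by linarith)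
      rw [abs_div, abs_div, abs_of_pos h0, abs_of_pos hd0, ← mul_div_assoc,
        div_le_div_iff₀ hd0 h0]
      nlinarith [mul_le_mul_of_nonneg_left h1.le (abs_nonneg (ζ x))]
    · rw [image_eq_zero_of_notMem_tsupport hx, zero_div, abs_zero, Real.zero_rpow (by linarith)]
      exact mul_nonneg (by positivity) (Finset.sum_nonneg fun i _ => hnn i)
  have hpt2 : ∀ x, ∑ i, (C i).indicator (fun x => ‖gradient ζ x‖ ^ p) x ≤ ‖gradient ζ x‖ ^ p := by
    intro x
    by_cases h : ∃ i, x ∈ C i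
    · obtain ⟨i, hi⟩ := h
      rw [Finset.sum_eq_single i]
      · rw [indicator_of_mem hi]
      · intro j _ hj
        apply indicator_of_notMem
        intro hxj
        rcases lt_or_gt_of_ne hj with h | h
        · exact absurd (hi.2 j h) (not_lt.2 (hxj.1 i))
        · exact absurd (hxj.2 i h) (not_lt.2 (hi.1 j))
      · simp
    · push Not at h
      simp only [h, not_false_eq_true, indicator_of_notMem, Finset.sum_const_zero]
      positivity
  have hI : ∀ i, Integrable ((C i).indicator (fun x => |ζ x / d i x| ^ p)) := fun i =>
    (hcell i).1.indicator (hCm i)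
  have hκ : 0 ≤ (p / (p - 1)) ^ p := Real.rpow_nonneg (div_nonneg (by linarith) (by linarith)) _
  calc ∫ x, |ζ x / Metric.infDist x (frontier Ω)| ^ p
      ≤ ∫ x, (1 + ε) ^ p * ∑ i, (C i).indicator (fun x => |ζ x / d i x| ^ p) x := by
        apply integral_mono_of_nonneg (.of_forall fun x => by positivity) _ (.of_forall hpt)
        exact (integrable_finsetSum _ fun i _ => hI i).const_mul _
    _ = (1 + ε) ^ p * ∑ i, ∫ x in C i, |ζ x / d i x| ^ p := by
        rw [integral_const_mul, integral_finsetSum _ fun i _ => hI i]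
        simp_rw [integral_indicator (hCm _)]
    _ ≤ (1 + ε) ^ p * ∑ i, (p / (p - 1)) ^ p * ∫ x in C i, ‖gradient ζ x‖ ^ p := by
        gcongr with i
        exact (hcell i).2
    _ = (1 + ε) ^ p * ((p / (p - 1)) ^ p *
          ∫ x, ∑ i, (C i).indicator (fun x => ‖gradient ζ x‖ ^ p) x) := by
        rw [← Finset.mul_sum, integral_finsetSum _ fun i _ => hgi.indicator (hCm i)]
        simp_rw [integral_indicator (hCm _)]
    _ ≤ (1 + ε) ^ p * ((p / (p - 1)) ^ p * ∫ x, ‖gradient ζ x‖ ^ p) := by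
        gcongr
        · exact integrable_finsetSum _ fun i _ => hgi.indicator (hCm i)
        · exact hpt2

/-- Hardy's inequality on bounded convex domains, with the sharp constant
`(p/(p-1))^p`, where `δ x = dist (x, ∂Ω)`. -/
theorem hardy_convex
    (n : ℕ) (p : ℝ) (hp : 1 < p)
    (Ω : Set (EuclideanSpace ℝ (Fin n))) (hΩo : IsOpen Ω)
    (hΩconv : Convex ℝ Ω) (hΩb : Bornology.IsBounded Ω)
    (ζ : EuclideanSpace ℝ (Fin n) → ℝ)
    (hζ : ContDiff ℝ (⊤ : ℕ∞) ζ) (hζc : HasCompactSupport ζ) (hζs : tsupport ζ ⊆ Ω) :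
    ∫ x in Ω, |ζ x / Metric.infDist x (frontier Ω)| ^ p
      ≤ (p / (p - 1)) ^ p * ∫ x in Ω, ‖gradient ζ x‖ ^ p := by
  have hp0 : p ≠ 0 := by linarith
  have h1 : ∫ x in Ω, |ζ x / Metric.infDist x (frontier Ω)| ^ p
      = ∫ x, |ζ x / Metric.infDist x (frontier Ω)| ^ p := by
    apply setIntegral_eq_integral_of_forall_compl_eq_zero
    intro x hx
    simp [image_eq_zero_of_notMem_tsupport (fun h => hx (hζs h)), hp0]
  have h2 : ∫ x in Ω, ‖gradient ζ x‖ ^ p = ∫ x, ‖gradient ζ x‖ ^ p := by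
    apply setIntegral_eq_integral_of_forall_compl_eq_zero
    intro x hx
    simp [gradient, fderiv_of_notMem_tsupport ℝ (fun h => hx (hζs h)), hp0]
  rw [h1, h2]
  rcases (frontier Ω).eq_empty_or_nonempty with hne | hne
  · have hκ : 0 ≤ (p / (p - 1)) ^ p :=
      Real.rpow_nonneg (div_nonneg (by linarith) (by linarith)) _
    simp only [hne, infDist_empty, div_zero, abs_zero, Real.zero_rpow hp0, integral_zero]
    exact mul_nonneg hκ (integral_nonneg fun x => by positivity)
  · have key := hc_eps n p hp Ω hΩo hΩconv hΩb hne ζ (hζ.of_le (by exact_mod_cast le_top)) hζc hζs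
    have hlim : Filter.Tendsto (fun ε : ℝ => (1 + ε) ^ p *
        ((p / (p - 1)) ^ p * ∫ x, ‖gradient ζ x‖ ^ p)) (nhdsWithin 0 (Ioi 0))
        (nhds ((1 + 0) ^ p * ((p / (p - 1)) ^ p * ∫ x, ‖gradient ζ x‖ ^ p))) := by
      apply Filter.Tendsto.mono_left _ nhdsWithin_le_nhds
      apply Filter.Tendsto.mul_const
      apply Filter.Tendsto.rpow_const
      · exact tendsto_const_nhds.add Filter.tendsto_id
      · right; linarith
    rw [add_zero, Real.one_rpow, one_mul] at hlim
    refine ge_of_tendsto hlim ?_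
    filter_upwards [self_mem_nhdsWithin] with ε hε using key ε hε
end

section
/- Let Ω ⊆ ℝⁿ be a nonempty open set and let δ(x) = dist(x, ∂Ω). Then δ satisfies the eikonal equation almost everywhere: for Lebesgue-almost every x ∈ Ω, δ is differentiable at x and |∇δ(x)| = 1. -/
open MeasureTheory Metric Set

/-- The distance to the boundary `δ x = dist (x, ∂Ω)` of a nonempty open set
`Ω ≠ ℝⁿ` satisfies the eikonal equation `|∇δ| = 1` almost everywhere in `Ω`. -/
theorem eikonal_ae
    (n : ℕ)
    (Ω : Set (EuclideanSpace ℝ (Fin n))) (hΩo : IsOpen Ω)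
    (hΩne : Ω.Nonempty) (hΩuniv : Ω ≠ Set.univ) :
    ∀ᵐ x ∂volume, x ∈ Ω →
      DifferentiableAt ℝ (fun y => Metric.infDist y (frontier Ω)) x ∧
      ‖gradient (fun y => Metric.infDist y (frontier Ω)) x‖ = 1 := by
  have hne : (frontier Ω).Nonempty := nonempty_frontier_iff.2 ⟨hΩne, hΩuniv⟩
  have hL : LipschitzWith 1 (fun y => Metric.infDist y (frontier Ω)) :=
    Metric.lipschitz_infDist_pt _
  filter_upwards [hL.ae_differentiableAt (μ := volume)] with x hd hx
  refine ⟨hd, ?_⟩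
  obtain ⟨y, hy, hxy⟩ := isClosed_frontier.exists_infDist_eq_dist hne x
  have hne' : y ≠ x := by
    rintro rfl
    rw [hΩo.frontier_eq] at hy
    exact hy.2 hx
  have hpos : 0 < ‖y - x‖ := norm_pos_iff.2 (sub_ne_zero.2 hne')
  have hxy' : Metric.infDist x (frontier Ω) = ‖y - x‖ := by
    rw [hxy, dist_comm, dist_eq_norm]
  set f : EuclideanSpace ℝ (Fin n) → ℝ := fun y => Metric.infDist y (frontier Ω) with hf
  have hg : ∀ t ∈ Set.Icc (0 : ℝ) 1, f (x + t • (y - x)) = (1 - t) * ‖y - x‖ := by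
    intro t ht
    have h1 : f (x + t • (y - x)) ≤ dist (x + t • (y - x)) y := Metric.infDist_le_dist_of_mem hy
    have h2 : Metric.infDist x (frontier Ω) ≤ f (x + t • (y - x)) + dist x (x + t • (y - x)) :=
      Metric.infDist_le_infDist_add_dist
    have e1 : dist (x + t • (y - x)) y = (1 - t) * ‖y - x‖ := by
      rw [dist_comm, dist_eq_norm]
      have : y - (x + t • (y - x)) = (1 - t) • (y - x) := by module
      rw [this, norm_smul, Real.norm_of_nonneg (by linarith [ht.2])]
    have e2 : dist x (x + t • (y - x)) = t * ‖y - x‖ := by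
      rw [dist_self_add_right, norm_smul, Real.norm_of_nonneg ht.1]
    rw [e1] at h1
    rw [e2, hxy'] at h2
    linarith
  have hline : HasDerivAt (fun t : ℝ => f (x + t • (y - x))) (fderiv ℝ f x (y - x)) 0 := by
    have := hd.hasFDerivAt.hasLineDerivAt (y - x)
    exact this
  have h2 : HasDerivWithinAt (fun t : ℝ => f (x + t • (y - x))) (-‖y - x‖) (Set.Icc 0 1) 0 := by
    have h3 : HasDerivAt (fun t : ℝ => (1 - t) * ‖y - x‖) (-‖y - x‖) 0 := by
      simpa using ((hasDerivAt_id (0 : ℝ)).const_sub 1).mul_const ‖y - x‖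
    exact h3.hasDerivWithinAt.congr hg (hg 0 (by simp))
  have hu : UniqueDiffWithinAt ℝ (Set.Icc (0 : ℝ) 1) 0 :=
    uniqueDiffOn_Icc zero_lt_one 0 (by simp)
  have heq : fderiv ℝ f x (y - x) = -‖y - x‖ := hu.eq_deriv _ hline.hasDerivWithinAt h2
  have hle : ‖fderiv ℝ f x‖ ≤ 1 := by
    simpa using norm_fderiv_le_of_lipschitz ℝ hL (x₀ := x)
  have hge : 1 ≤ ‖fderiv ℝ f x‖ := by
    have := (fderiv ℝ f x).le_opNorm (y - x)
    rw [heq, norm_neg, norm_norm] at this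
    exact le_of_mul_le_mul_right (by linarith) hpos
  rw [gradient, LinearIsometryEquiv.norm_map]
  exact le_antisymm hle hge
end

section
/- Let n < p < ∞ and let Ω ⊆ ℝⁿ be any bounded nonempty open set with δ(x) = dist(x, ∂Ω). Then for every smooth function ζ with compact support in Ω, ∫_Ω |ζ(x)/δ(x)|^p dx ≤ (p/(p−n))^p ∫_Ω |∇ζ(x)|^p dx. -/
open MeasureTheory Metric Set

namespace HardyAux

open scoped ENNReal

lemma lint_rpow (s : ℝ) (hs : s < 1) :
    ∫⁻ t in Ioo (0:ℝ) 1, ENNReal.ofReal (t ^ (-s)) = ENNReal.ofReal (1 / (1 - s)) := by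
  have hi : IntervalIntegrable (fun t : ℝ => t ^ (-s)) volume 0 1 :=
    intervalIntegral.intervalIntegrable_rpow' (by linarith)
  rw [intervalIntegrable_iff_integrableOn_Ioo_of_le zero_le_one] at hi
  rw [← ofReal_integral_eq_lintegral_ofReal hi]
  · rw [← integral_Ioc_eq_integral_Ioo, ← intervalIntegral.integral_of_le zero_le_one,
      integral_rpow (Or.inl (by linarith))]
    congr 1
    rw [Real.zero_rpow (by linarith), Real.one_rpow]
    ring
  · filter_upwards [ae_restrict_mem measurableSet_Ioo] with t ht
    exact Real.rpow_nonneg ht.1.le _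

lemma holder1 (p s : ℝ) (hp : 1 < p) (hs : s < 1) (g : ℝ → ℝ≥0∞) (hg : Measurable g) :
    (∫⁻ t in Ioo (0:ℝ) 1, g t) ^ p ≤ ENNReal.ofReal (1 / (1 - s)) ^ (p - 1) *
      ∫⁻ t in Ioo (0:ℝ) 1, g t ^ p * ENNReal.ofReal (t ^ (s * (p - 1))) := by
  have hp0 : 0 < p := by linarith
  have hpq : p.HolderConjugate (p / (p - 1)) := Real.HolderConjugate.conjExponent hp
  set q := p / (p - 1) with hq
  have hq0 : 0 < q := hpq.symm.pos
  have hqi : 1 / q = (p - 1) / p := by rw [hq]; field_simp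
  have hm : ∀ a : ℝ, Measurable (fun t : ℝ => ENNReal.ofReal (t ^ a)) := fun a => by fun_prop
  have H := ENNReal.lintegral_mul_le_Lp_mul_Lq (volume.restrict (Ioo (0:ℝ) 1)) hpq
    (f := fun t => g t * ENNReal.ofReal (t ^ (s / q)))
    (g := fun t => ENNReal.ofReal (t ^ (-(s / q))))
    (hg.mul (hm _)).aemeasurable (hm _).aemeasurable
  have e1 : ∫⁻ t in Ioo (0:ℝ) 1, ((fun t => g t * ENNReal.ofReal (t ^ (s / q))) *
      (fun t => ENNReal.ofReal (t ^ (-(s / q))))) t = ∫⁻ t in Ioo (0:ℝ) 1, g t := by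
    refine setLIntegral_congr_fun measurableSet_Ioo fun t ht => ?_
    have h0 := ht.1
    simp only [Pi.mul_apply]
    rw [mul_assoc, ← ENNReal.ofReal_mul (Real.rpow_nonneg h0.le _), ← Real.rpow_add h0]
    simp
  have e2 : ∫⁻ t in Ioo (0:ℝ) 1, (g t * ENNReal.ofReal (t ^ (s / q))) ^ p =
      ∫⁻ t in Ioo (0:ℝ) 1, g t ^ p * ENNReal.ofReal (t ^ (s * (p - 1))) := by
    refine setLIntegral_congr_fun measurableSet_Ioo fun t ht => ?_
    have h0 := ht.1
    rw [ENNReal.mul_rpow_of_nonneg _ _ hp0.le, ENNReal.ofReal_rpow_of_pos (Real.rpow_pos_of_pos h0 _),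
      ← Real.rpow_mul h0.le]
    congr 3
    rw [hq]; field_simp
  have e3 : ∫⁻ t in Ioo (0:ℝ) 1, (ENNReal.ofReal (t ^ (-(s / q)))) ^ q =
      ENNReal.ofReal (1 / (1 - s)) := by
    rw [← lint_rpow s hs]
    refine setLIntegral_congr_fun measurableSet_Ioo fun t ht => ?_
    have h0 := ht.1
    rw [ENNReal.ofReal_rpow_of_pos (Real.rpow_pos_of_pos h0 _), ← Real.rpow_mul h0.le]
    congr 2
    field_simp
  rw [e1, e2, e3] at H
  calc _ ≤ _ := ENNReal.rpow_le_rpow H hp0.le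
    _ = _ := by
      rw [ENNReal.mul_rpow_of_nonneg _ _ hp0.le, ← ENNReal.rpow_mul, ← ENNReal.rpow_mul, hqi]
      have : 1 / p * p = 1 := by field_simp
      have h2 : (p - 1) / p * p = p - 1 := by field_simp
      rw [this, h2, ENNReal.rpow_one, mul_comm]

lemma dil (n : ℕ) (q : EuclideanSpace ℝ (Fin n)) (t : ℝ) (ht : 0 < t)
    (f : EuclideanSpace ℝ (Fin n) → ℝ≥0∞) (hf : Measurable f) :
    ∫⁻ x, f (q + t • (x - q)) = ENNReal.ofReal ((t ^ n)⁻¹) * ∫⁻ x, f x := by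
  have h1 : ∫⁻ x, f (q + t • (x - q)) = ∫⁻ x, f (q + t • x) :=
    lintegral_sub_right_eq_self (μ := volume) (fun x => f (q + t • x)) q
  have h2 : ∫⁻ x, f (q + t • x) = ∫⁻ y, f (q + y) ∂(Measure.map (t • ·) volume) := by
    rw [lintegral_map (by fun_prop) (by fun_prop)]
  rw [h1, h2, Measure.map_addHaar_smul _ ht.ne', lintegral_smul_measure, smul_eq_mul,
    lintegral_add_left_eq_self (μ := volume) f q]
  simp [abs_of_pos ht]

lemma ftc {n : ℕ} (ζ : EuclideanSpace ℝ (Fin n) → ℝ) (hζ : ContDiff ℝ (⊤ : ℕ∞) ζ)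
    (q x : EuclideanSpace ℝ (Fin n)) (hq : ζ q = 0) :
    ‖ζ x‖ₑ ≤ (∫⁻ t in Ioo (0:ℝ) 1, ‖fderiv ℝ ζ (q + t • (x - q))‖ₑ) * ‖x - q‖ₑ := by
  have hc : Continuous (fderiv ℝ ζ) := hζ.continuous_fderiv (by simp)
  have hd : ∀ t : ℝ, HasDerivAt (fun t : ℝ => ζ (q + t • (x - q)))
      (fderiv ℝ ζ (q + t • (x - q)) (x - q)) t := fun t => by
    have h1 : HasDerivAt (fun t : ℝ => q + t • (x - q)) (x - q) t := by
      simpa using ((hasDerivAt_id t).smul_const (x - q)).const_add q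
    exact ((hζ.differentiable (by simp)) _).hasFDerivAt.comp_hasDerivAt t h1
  have hcont : Continuous fun t : ℝ => fderiv ℝ ζ (q + t • (x - q)) (x - q) := by fun_prop
  have := intervalIntegral.integral_eq_sub_of_hasDerivAt (a := 0) (b := 1) (fun t _ => hd t)
    (hcont.intervalIntegrable _ _)
  simp only [one_smul, add_sub_cancel, zero_smul, add_zero, hq, sub_zero] at this
  rw [← this, intervalIntegral.integral_of_le zero_le_one, integral_Ioc_eq_integral_Ioo]
  refine (enorm_integral_le_lintegral_enorm _).trans ?_
  rw [← lintegral_mul_const' _ _ (by simp)]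
  exact lintegral_mono fun t => ContinuousLinearMap.le_opENorm _ _

lemma cell {n : ℕ} (p : ℝ) (hp1 : 1 < p) (hp : (n : ℝ) < p)
    (ζ : EuclideanSpace ℝ (Fin n) → ℝ) (hζ : ContDiff ℝ (⊤ : ℕ∞) ζ)
    (q : EuclideanSpace ℝ (Fin n)) (hq : ζ q = 0) (V : Set (EuclideanSpace ℝ (Fin n)))
    (hV : MeasurableSet V)
    (hst : ∀ x ∈ V, ∀ t ∈ Ioo (0:ℝ) 1, q + t • (x - q) ∈ V) :
    ∫⁻ x in V, (‖ζ x‖ₑ / ‖x - q‖ₑ) ^ p ≤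
      ENNReal.ofReal (p / (p - n)) ^ p * ∫⁻ x in V, ‖fderiv ℝ ζ x‖ₑ ^ p := by
  have hp0 : 0 < p := by linarith
  have hpn : 0 < p - n := by linarith
  set s : ℝ := n / p with hs
  have hs1 : s < 1 := by rw [hs, div_lt_one hp0]; exact hp
  have hC : 1 / (1 - s) = p / (p - n) := by rw [hs]; field_simp
  set C := ENNReal.ofReal (p / (p - n)) with hCd
  have hc : Continuous (fderiv ℝ ζ) := hζ.continuous_fderiv (by simp)
  set g : EuclideanSpace ℝ (Fin n) → ℝ≥0∞ := fun x => ‖fderiv ℝ ζ x‖ₑ with hg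
  have hgm : Measurable g := hc.enorm.measurable
  have hpt : ∀ x, (‖ζ x‖ₑ / ‖x - q‖ₑ) ^ p ≤
      C ^ (p - 1) * ∫⁻ t in Ioo (0:ℝ) 1,
        g (q + t • (x - q)) ^ p * ENNReal.ofReal (t ^ (s * (p - 1))) := by
    intro x
    rw [hCd, ← hC]
    refine le_trans ?_ (holder1 p s hp1 hs1 (fun t => g (q + t • (x - q))) (by fun_prop))
    refine ENNReal.rpow_le_rpow ?_ hp0.le
    exact ENNReal.div_le_of_le_mul (ftc ζ hζ q x hq)
  have hin : ∀ t ∈ Ioo (0:ℝ) 1, ∫⁻ x in V, g (q + t • (x - q)) ^ p ≤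
      ENNReal.ofReal ((t ^ n)⁻¹) * ∫⁻ x in V, g x ^ p := by
    intro t ht
    rw [← lintegral_indicator hV, ← lintegral_indicator hV (fun x => g x ^ p),
      ← dil n q t ht.1 _ ((hgm.pow_const p).indicator hV)]
    refine lintegral_mono fun x => ?_
    by_cases hx : x ∈ V
    · simp [hx, hst x hx t ht]
    · simp [hx]
  calc _ ≤ ∫⁻ x in V, C ^ (p - 1) * ∫⁻ t in Ioo (0:ℝ) 1,
        g (q + t • (x - q)) ^ p * ENNReal.ofReal (t ^ (s * (p - 1))) := lintegral_mono hpt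
    _ = C ^ (p - 1) * ∫⁻ x in V, ∫⁻ t in Ioo (0:ℝ) 1,
        g (q + t • (x - q)) ^ p * ENNReal.ofReal (t ^ (s * (p - 1))) :=
      lintegral_const_mul' _ _ (ENNReal.rpow_ne_top_of_nonneg (by linarith) (by simp [hCd]))
    _ = C ^ (p - 1) * ∫⁻ t in Ioo (0:ℝ) 1, ∫⁻ x in V,
        g (q + t • (x - q)) ^ p * ENNReal.ofReal (t ^ (s * (p - 1))) := by
      rw [lintegral_lintegral_swap]
      apply Measurable.aemeasurable
      unfold Function.uncurry
      fun_prop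
    _ ≤ C ^ (p - 1) * ∫⁻ t in Ioo (0:ℝ) 1, ENNReal.ofReal (t ^ (-s)) * ∫⁻ x in V, g x ^ p := by
      refine mul_le_mul' le_rfl ?_
      refine setLIntegral_mono' measurableSet_Ioo fun t ht => ?_
      rw [lintegral_mul_const' _ _ (by simp)]
      refine (mul_le_mul_left (hin t ht) _).trans (le_of_eq ?_)
      rw [mul_right_comm, ← ENNReal.ofReal_mul (by have := ht.1; positivity)]
      congr 2
      rw [← Real.rpow_natCast, ← Real.rpow_neg ht.1.le, ← Real.rpow_add ht.1]
      congr 1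
      rw [hs]; field_simp; ring
    _ = C ^ p * ∫⁻ x in V, g x ^ p := by
      rw [lintegral_mul_const _ (by fun_prop), lint_rpow s hs1, hC, ← hCd, ← mul_assoc]
      congr 1
      have hC0 : C ≠ 0 := by simp [hCd]; positivity
      nth_rewrite 2 [← ENNReal.rpow_one C]
      rw [← ENNReal.rpow_add _ _ hC0 (by simp [hCd])]
      simp

lemma fin_hardy {n k : ℕ} (hk : 0 < k) (p : ℝ) (hp1 : 1 < p) (hp : (n : ℝ) < p)
    (ζ : EuclideanSpace ℝ (Fin n) → ℝ) (hζ : ContDiff ℝ (⊤ : ℕ∞) ζ)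
    (q : Fin k → EuclideanSpace ℝ (Fin n)) (hq : ∀ i, ζ (q i) = 0)
    (m : EuclideanSpace ℝ (Fin n) → ℝ) (A : ℝ) (hA : 0 < A)
    (hm : ∀ x, ζ x ≠ 0 → 0 < m x)
    (hmA : ∀ x i, ζ x ≠ 0 → (∀ j, dist x (q i) ≤ dist x (q j)) → dist x (q i) ≤ A * m x) :
    ∫⁻ x, ENNReal.ofReal (|ζ x / m x| ^ p) ≤
      ENNReal.ofReal (A ^ p) * (ENNReal.ofReal (p / (p - n)) ^ p *
        ∫⁻ x, ‖fderiv ℝ ζ x‖ₑ ^ p) := by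
  have hp0 : 0 < p := by linarith
  haveI : Nonempty (Fin k) := ⟨⟨0, hk⟩⟩
  set V : Fin k → Set (EuclideanSpace ℝ (Fin n)) := fun i =>
    {x | (∀ j, j < i → dist x (q i) < dist x (q j)) ∧ ∀ j, dist x (q i) ≤ dist x (q j)} with hVd
  have hVm : ∀ i, MeasurableSet (V i) := by
    intro i
    have h1 : MeasurableSet {x | ∀ j, j < i → dist x (q i) < dist x (q j)} := by
      simp only [setOf_forall]
      refine MeasurableSet.iInter fun j => MeasurableSet.iInter fun _ => ?_
      exact measurableSet_lt (by fun_prop) (by fun_prop)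
    have h2 : MeasurableSet {x | ∀ j, dist x (q i) ≤ dist x (q j)} := by
      simp only [setOf_forall]
      refine MeasurableSet.iInter fun j => ?_
      exact measurableSet_le (by fun_prop) (by fun_prop)
    exact h1.inter h2
  have hVd : Pairwise (Function.onFun Disjoint V) := by
    intro i j hij
    rw [Function.onFun, Set.disjoint_left]
    rintro x ⟨h1, h2⟩ ⟨h3, h4⟩
    rcases lt_or_gt_of_ne hij with h | h
    · exact absurd (h3 i h) (not_lt.2 (h2 j))
    · exact absurd (h1 j h) (not_lt.2 (h4 i))
  have hVu : ⋃ i, V i = univ := by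
    refine eq_univ_of_forall fun x => ?_
    have hne : {i | ∀ j, dist x (q i) ≤ dist x (q j)}.Nonempty := by
      obtain ⟨i, hi⟩ := Finite.exists_min (fun i => dist x (q i))
      exact ⟨i, hi⟩
    obtain ⟨i, hi, hmin⟩ := wellFounded_lt.has_min _ hne
    refine mem_iUnion.2 ⟨i, fun j hj => ?_, hi⟩
    by_contra hcon
    exact hmin j (fun l => (not_lt.1 hcon).trans (hi l)) hj
  have hst : ∀ i, ∀ x ∈ V i, ∀ t ∈ Ioo (0:ℝ) 1, q i + t • (x - q i) ∈ V i := by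
    rintro i x ⟨h1, h2⟩ t ⟨ht0, ht1⟩
    have e1 : dist (q i + t • (x - q i)) (q i) = t * dist x (q i) := by
      rw [dist_eq_norm, dist_eq_norm, add_sub_cancel_left, norm_smul, Real.norm_of_nonneg ht0.le]
    have e2 : dist x (q i + t • (x - q i)) = (1 - t) * dist x (q i) := by
      rw [dist_eq_norm, dist_eq_norm, ← Real.norm_of_nonneg (sub_nonneg.2 ht1.le), ← norm_smul]
      congr 1
      module
    have e3 : ∀ j, dist x (q j) ≤ (1 - t) * dist x (q i) + dist (q i + t • (x - q i)) (q j) :=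
      fun j => by rw [← e2]; exact dist_triangle _ _ _
    refine ⟨fun j hj => ?_, fun j => ?_⟩
    · rw [e1]; linarith [e3 j, h1 j hj]
    · rw [e1]; linarith [e3 j, h2 j]
  have hpt : ∀ i, ∀ x ∈ V i, ENNReal.ofReal (|ζ x / m x| ^ p) ≤
      ENNReal.ofReal (A ^ p) * (‖ζ x‖ₑ / ‖x - q i‖ₑ) ^ p := by
    rintro i x ⟨-, hx⟩
    by_cases h0 : ζ x = 0
    · simp [h0, Real.zero_rpow hp0.ne']
    have hm0 := hm x h0
    have hd := hmA x i h0 hx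
    have hne : x ≠ q i := fun h => h0 (by rw [h]; exact hq i)
    have hpos : 0 < ‖x - q i‖ := norm_pos_iff.2 (sub_ne_zero.2 hne)
    rw [dist_eq_norm] at hd
    rw [← ofReal_norm_eq_enorm, ← ofReal_norm_eq_enorm, ← ENNReal.ofReal_div_of_pos hpos,
      ENNReal.ofReal_rpow_of_nonneg (by positivity) hp0.le, ← ENNReal.ofReal_mul (by positivity),
      ← Real.mul_rpow hA.le (by positivity)]
    refine ENNReal.ofReal_le_ofReal (Real.rpow_le_rpow (abs_nonneg _) ?_ hp0.le)
    rw [abs_div, abs_of_pos hm0, Real.norm_eq_abs, ← mul_div_assoc, div_le_div_iff₀ hm0 hpos]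
    nlinarith [abs_nonneg (ζ x)]
  have hsplit : ∀ f : EuclideanSpace ℝ (Fin n) → ℝ≥0∞, ∫⁻ x, f x = ∑' i, ∫⁻ x in V i, f x := by
    intro f
    rw [← lintegral_iUnion hVm hVd, hVu, Measure.restrict_univ]
  rw [hsplit, hsplit, ← ENNReal.tsum_mul_left, ← ENNReal.tsum_mul_left]
  refine ENNReal.tsum_le_tsum fun i => ?_
  calc _ ≤ ∫⁻ x in V i, ENNReal.ofReal (A ^ p) * (‖ζ x‖ₑ / ‖x - q i‖ₑ) ^ p :=
        setLIntegral_mono' (hVm i) (hpt i)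
    _ = ENNReal.ofReal (A ^ p) * ∫⁻ x in V i, (‖ζ x‖ₑ / ‖x - q i‖ₑ) ^ p :=
        lintegral_const_mul' _ _ (by simp)
    _ ≤ _ := mul_le_mul' le_rfl (cell p hp1 hp ζ hζ (q i) (hq i) (V i) (hVm i) (hst i))

end HardyAux

/-- Hardy's inequality for `p > n` in an arbitrary bounded nonempty open set,
with constant `(p/(p-n))^p`, where `δ x = dist (x, ∂Ω)`. -/
theorem hardy_p_gt_n
    (n : ℕ) (hn : 0 < n) (p : ℝ) (hp : (n : ℝ) < p)
    (Ω : Set (EuclideanSpace ℝ (Fin n))) (hΩo : IsOpen Ω)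
    (hΩne : Ω.Nonempty) (hΩb : Bornology.IsBounded Ω)
    (ζ : EuclideanSpace ℝ (Fin n) → ℝ)
    (hζ : ContDiff ℝ (⊤ : ℕ∞) ζ) (hζc : HasCompactSupport ζ) (hζs : tsupport ζ ⊆ Ω) :
    ∫ x in Ω, |ζ x / Metric.infDist x (frontier Ω)| ^ p
      ≤ (p / (p - n)) ^ p * ∫ x in Ω, ‖gradient ζ x‖ ^ p := by
  have hn1 : (1 : ℝ) ≤ n := by exact_mod_cast hn
  have hp1 : 1 < p := by linarith
  have hp0 : 0 < p := by linarith
  have hpn : 0 < p - n := by linarith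
  have hC0 : 0 < p / (p - n) := by positivity
  have hgr : ∀ x, ‖gradient ζ x‖ = ‖fderiv ℝ ζ x‖ := fun x => by
    rw [← toDual_gradient, LinearIsometryEquiv.norm_map]
  have hc : Continuous (fderiv ℝ ζ) := hζ.continuous_fderiv (by simp)
  have hRnn : 0 ≤ ∫ x in Ω, ‖gradient ζ x‖ ^ p :=
    integral_nonneg fun x => by positivity
  rcases (frontier Ω).eq_empty_or_nonempty with hfe | hfne
  · simp only [hfe, infDist_empty, div_zero, abs_zero, Real.zero_rpow hp0.ne', integral_zero]
    positivity
  have hfc : IsCompact (frontier Ω) := isCompact_of_isClosed_isBounded isClosed_frontier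
    (hΩb.closure.subset frontier_subset_closure)
  have hdis : ∀ y ∈ frontier Ω, y ∉ Ω := fun y hy hy2 => by
    rw [hΩo.frontier_eq] at hy; exact hy.2 hy2
  have hz : ∀ y ∈ frontier Ω, ζ y = 0 := fun y hy =>
    image_eq_zero_of_notMem_tsupport fun h => hdis y hy (hζs h)
  obtain ⟨c, hc0, hcs⟩ := IsCompact.exists_thickening_subset_open hζc hΩo hζs
  have hcd : ∀ x, ζ x ≠ 0 → c ≤ infDist x (frontier Ω) := by
    intro x hx
    rw [le_infDist hfne]
    intro y hy
    by_contra hcon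
    refine hdis y hy (hcs (mem_thickening_iff.2 ⟨x, subset_tsupport _ hx, ?_⟩))
    rw [dist_comm]; exact not_le.1 hcon
  -- the right-hand side
  have hint : Integrable (fun x => ‖fderiv ℝ ζ x‖ ^ p) := by
    apply Continuous.integrable_of_hasCompactSupport
    · exact hc.norm.rpow_const fun _ => Or.inr hp0.le
    · exact (hζc.fderiv ℝ).comp_left (g := fun L => ‖L‖ ^ p) (by simp [Real.zero_rpow hp0.ne'])
  have hRe : ∫ x in Ω, ‖gradient ζ x‖ ^ p = ∫ x, ‖fderiv ℝ ζ x‖ ^ p := by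
    simp_rw [hgr]
    apply setIntegral_eq_integral_of_forall_compl_eq_zero
    intro x hx
    have : fderiv ℝ ζ x = 0 := by
      by_contra h
      exact hx (hζs (support_fderiv_subset ℝ h))
    simp [this, Real.zero_rpow hp0.ne']
  have hRl : ∫⁻ x, ‖fderiv ℝ ζ x‖ₑ ^ p = ENNReal.ofReal (∫ x, ‖fderiv ℝ ζ x‖ ^ p) := by
    rw [ofReal_integral_eq_lintegral_ofReal hint (Filter.Eventually.of_forall fun x => by positivity)]
    refine lintegral_congr fun x => ?_
    rw [← ofReal_norm_eq_enorm, ENNReal.ofReal_rpow_of_nonneg (norm_nonneg _) hp0.le]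
  rw [hRe]
  rw [hRe] at hRnn
  set G := ∫ x, ‖fderiv ℝ ζ x‖ ^ p
  -- approximate inequality
  have key : ∀ ε : ℝ, 0 < ε → ∫ x in Ω, |ζ x / Metric.infDist x (frontier Ω)| ^ p ≤
      (1 + ε) ^ p * ((p / (p - n)) ^ p * G) := by
    intro ε hε
    obtain ⟨t, hts, htf, htc⟩ := finite_cover_balls_of_compact hfc (mul_pos hε hc0)
    lift t to Finset (EuclideanSpace ℝ (Fin n)) using htf
    set q : Fin t.card → EuclideanSpace ℝ (Fin n) := fun i => (t.equivFin.symm i : _) with hqd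
    have hk : 0 < t.card := by
      obtain ⟨y, hy⟩ := hfne
      obtain ⟨a, ha, -⟩ := mem_iUnion₂.1 (htc hy)
      exact Finset.card_pos.2 ⟨a, ha⟩
    have H := HardyAux.fin_hardy hk p hp1 hp ζ hζ q (fun i => hz _ (hts (t.equivFin.symm i).2))
      (fun x => infDist x (frontier Ω)) (1 + ε) (by linarith)
      (fun x hx => hc0.trans_le (hcd x hx)) (by
        intro x i hx hi
        obtain ⟨y, hy, hye⟩ := hfc.exists_infDist_eq_dist hfne x
        obtain ⟨a, ha, hay⟩ := mem_iUnion₂.1 (htc hy)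
        have h1 := hi (t.equivFin ⟨a, ha⟩)
        have h2 : q (t.equivFin ⟨a, ha⟩) = a := by simp [hqd]
        rw [h2] at h1
        have h3 := hcd x hx
        have h4 := dist_triangle x y a
        rw [mem_ball] at hay
        nlinarith)
    rw [integral_eq_lintegral_of_nonneg_ae (Filter.Eventually.of_forall fun x => by positivity)]
    · refine ENNReal.toReal_le_of_le_ofReal (by positivity) ?_
      refine (setLIntegral_le_lintegral _ _).trans (H.trans (le_of_eq ?_))
      rw [hRl, ENNReal.ofReal_rpow_of_pos hC0, ← ENNReal.ofReal_mul (by positivity),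
        ← ENNReal.ofReal_mul (by positivity)]
    · apply Measurable.aestronglyMeasurable
      have := hζ.continuous.measurable
      have h2 : Measurable fun x => infDist x (frontier Ω) := measurable_infDist
      simp_rw [← Real.norm_eq_abs]
      exact (this.div h2).norm.pow_const p
  have hlim : Filter.Tendsto (fun ε : ℝ => (1 + ε) ^ p * ((p / (p - n)) ^ p * G))
      (nhdsWithin 0 (Ioi 0)) (nhds ((1 + 0) ^ p * ((p / (p - n)) ^ p * G))) := by
    refine Filter.Tendsto.mono_left (Continuous.tendsto ?_ 0) nhdsWithin_le_nhds
    exact ((continuous_const.add continuous_id).rpow_const fun _ => Or.inr hp0.le).mul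
      continuous_const
  rw [add_zero, Real.one_rpow, one_mul] at hlim
  refine ge_of_tendsto hlim ?_
  filter_upwards [self_mem_nhdsWithin] with ε hε using key ε hε
end

section
/- Let 1 < p < n, set β = (n − p)/(p − 1) > 0, let Ω ⊆ ℝⁿ be a bounded nonempty open set with δ(x) = dist(x, ∂Ω), and let R > 0. Define v(x) = R^{−β} − (R + δ(x))^{−β} on Ω. Then at every point x ∈ Ω where δ is differentiable with |∇δ(x)| = 1 (which holds for a.e. x ∈ Ω), |∇v(x)|/v(x) ≥ (1/δ(x)) · (R/(R + δ(x)))^β when β ≥ 1, and |∇v(x)|/v(x) ≥ (1/δ(x)) · R/(R + δ(x)) when 0 < β < 1. In particular |∇ log v(x)|^p ≥ C / δ(x)^p a.e. in Ω, where C = (R/(R + diam Ω))^{p·max(β,1)}. -/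
open MeasureTheory Metric Set

lemma aux_real (R d β : ℝ) (hR : 0 < R) (hd : 0 < d) (hβ : 0 < β) :
    0 < R ^ (-β) - (R + d) ^ (-β) ∧
    (1 / d) * (R / (R + d)) ^ (max β 1) ≤
      β * (R + d) ^ (-β - 1) / (R ^ (-β) - (R + d) ^ (-β)) := by
  have hS : 0 < R + d := by linarith
  have hpos : 0 < R ^ (-β) - (R + d) ^ (-β) := by
    have := Real.rpow_lt_rpow_of_neg hR (by linarith : R < R + d) (by linarith : -β < 0)
    linarith
  refine ⟨hpos, ?_⟩
  obtain ⟨s, hs⟩ : ∃ s, s = R / (R + d) := ⟨_, rfl⟩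
  have hs0 : 0 < s := by rw [hs]; positivity
  have hRs : R = s * (R + d) := by rw [hs]; field_simp
  have hds : d = (1 - s) * (R + d) := by linarith
  obtain ⟨T, hT⟩ : ∃ T, T = (R + d) ^ (-β) := ⟨_, rfl⟩
  have hT0 : 0 < T := by rw [hT]; positivity
  have e1 : (R + d) ^ (-β - 1) = T / (R + d) := by
    rw [Real.rpow_sub_one hS.ne', hT]
  have e2 : R ^ (-β) = s ^ (-β) * T := by
    conv_lhs => rw [hRs]
    rw [Real.mul_rpow hs0.le hS.le, hT]
  have key : s ^ (max β 1) * (s ^ (-β) - 1) ≤ β * (1 - s) := by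
    rw [mul_sub, ← Real.rpow_add hs0, mul_one]
    rcases le_total 1 β with h | h
    · rw [max_eq_left h, add_neg_cancel, Real.rpow_zero]
      have := one_add_mul_self_le_rpow_one_add (s := s - 1) (by linarith) h
      rw [add_sub_cancel] at this
      linarith
    · rw [max_eq_right h, Real.rpow_one]
      have := rpow_one_add_le_one_add_mul_self (s := s - 1) (p := 1 + -β) (by linarith)
        (by linarith) (by linarith)
      rw [add_sub_cancel] at this
      linarith
  rw [le_div_iff₀ hpos, ← hs, e1, e2, ← hT]
  have h1 : 1 / d * s ^ (max β 1) * (s ^ (-β) * T - T)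
      = (T / d) * (s ^ (max β 1) * (s ^ (-β) - 1)) := by ring
  have h2 : β * (T / (R + d)) = (T / d) * (β * (1 - s)) := by
    have : 1 - s = d / (R + d) := by rw [hs]; field_simp; ring
    rw [this]; field_simp
  rw [h1, h2]
  exact mul_le_mul_of_nonneg_left key (by positivity)

lemma aux_norm_gradient {E : Type*} [NormedAddCommGroup E] [InnerProductSpace ℝ E]
    [CompleteSpace E] (f : E → ℝ) (x : E) : ‖gradient f x‖ = ‖fderiv ℝ f x‖ := by
  simp [gradient]

lemma aux_grad_v {E : Type*} [NormedAddCommGroup E] [InnerProductSpace ℝ E]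
    [CompleteSpace E] (δ : E → ℝ) (x : E) (R β : ℝ) (hR : 0 < R) (hβ : 0 < β)
    (hx : 0 < δ x) (hd : DifferentiableAt ℝ δ x) (h1 : ‖gradient δ x‖ = 1) :
    ‖gradient (fun x => R ^ (-β) - (R + δ x) ^ (-β)) x‖ = β * (R + δ x) ^ (-β - 1) := by
  have hS : 0 < R + δ x := by linarith
  have h := (((hd.hasFDerivAt.const_add R).rpow_const (p := -β) (Or.inl hS.ne')).const_sub
    (R ^ (-β)))
  rw [aux_norm_gradient] at h1 ⊢
  rw [h.fderiv, norm_neg, norm_smul, h1, mul_one, Real.norm_eq_abs, abs_mul, abs_neg,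
    abs_of_pos hβ, abs_of_pos (by positivity)]

lemma aux_grad_dist {E : Type*} [NormedAddCommGroup E] [InnerProductSpace ℝ E]
    [CompleteSpace E] (K : Set E) (x y : E) (hy : y ∈ K) (hxy : infDist x K = dist x y)
    (hpos : 0 < infDist x K) (hd : DifferentiableAt ℝ (fun x => infDist x K) x) :
    ‖gradient (fun x => infDist x K) x‖ = 1 := by
  rw [aux_norm_gradient]
  set L := fderiv ℝ (fun x => infDist x K) x with hL
  apply le_antisymm
  · have := norm_fderiv_le_of_lipschitz ℝ (x₀ := x) (lipschitz_infDist_pt K)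
    simpa using this
  · have hc : HasDerivAt (fun t : ℝ => x + t • (y - x)) (y - x) 0 := by
      simpa using ((hasDerivAt_id (0:ℝ)).smul_const (y - x)).const_add x
    have hd' : HasFDerivAt (fun x => infDist x K) L (x + (0:ℝ) • (y - x)) := by
      simpa using hd.hasFDerivAt
    have hcomp := hd'.comp_hasDerivAt (0:ℝ) hc
    have hlin : HasDerivAt (fun t : ℝ => (1 - t) * dist x y) (-dist x y) 0 := by
      simpa using ((hasDerivAt_id (0:ℝ)).const_sub 1).mul_const (dist x y)
    have heq : ∀ t ∈ Icc (0:ℝ) 1, (1 - t) * dist x y =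
        ((fun x => infDist x K) ∘ fun t : ℝ => x + t • (y - x)) t := by
      intro t ht
      apply le_antisymm
      · have h := infDist_le_infDist_add_dist (s := K) (x := x) (y := x + t • (y - x))
        have h' : dist x (x + t • (y - x)) = t * dist x y := by
          rw [dist_self_add_right, norm_smul, Real.norm_of_nonneg ht.1, dist_comm, dist_eq_norm]
        rw [h', hxy] at h
        simp only [Function.comp]
        linarith
      · have h := infDist_le_dist_of_mem (x := x + t • (y - x)) hy
        have h' : dist (x + t • (y - x)) y = (1 - t) * dist x y := by
          have : x + t • (y - x) - y = (1 - t) • (x - y) := by module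
          rw [dist_eq_norm, this, norm_smul, Real.norm_of_nonneg (by linarith [ht.2]),
            dist_eq_norm]
        rw [h'] at h
        exact h
    have hLe : L (y - x) = -dist x y := by
      have ha := hcomp.hasDerivWithinAt (s := Icc (0:ℝ) 1)
      have hb := (hlin.hasDerivWithinAt (s := Icc (0:ℝ) 1))
      have hc := ha.congr heq (heq 0 (by simp))
      exact (uniqueDiffOn_Icc (zero_lt_one' ℝ) 0 (by simp)).eq_deriv _ hc hb
    have h2 := L.le_opNorm (y - x)
    rw [hLe, norm_neg, Real.norm_of_nonneg dist_nonneg, dist_comm, dist_eq_norm] at h2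
    have h3 : 0 < ‖y - x‖ := by rw [← dist_eq_norm, dist_comm, ← hxy]; exact hpos
    exact le_of_mul_le_mul_right (by linarith) h3


/-- Pointwise lower bound for the logarithmic gradient of
`v x = R^(-β) - (R + δ x)^(-β)`, where `δ x = dist (x, ∂Ω)` and
`β = (n-p)/(p-1)`: at points where `δ` is differentiable with `|∇δ| = 1`,
`|∇v|/v ≥ (1/δ)(R/(R+δ))^β` when `β ≥ 1` and `|∇v|/v ≥ (1/δ)·R/(R+δ)` when
`0 < β < 1`; in particular `|∇ log v|^p ≥ C/δ^p` a.e. in `Ω` with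
`C = (R/(R + diam Ω))^(p · max β 1)`. -/
theorem log_gradient_lower_bound
    (n : ℕ) (hn : 0 < n) (p : ℝ) (hp1 : 1 < p) (hpn : p < n)
    (R : ℝ) (hR : 0 < R)
    (Ω : Set (EuclideanSpace ℝ (Fin n))) (hΩo : IsOpen Ω)
    (hΩne : Ω.Nonempty) (hΩb : Bornology.IsBounded Ω)
    (β : ℝ) (hβ : β = (n - p) / (p - 1))
    (δ : EuclideanSpace ℝ (Fin n) → ℝ)
    (hδ : δ = fun x => Metric.infDist x (frontier Ω))
    (v : EuclideanSpace ℝ (Fin n) → ℝ)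
    (hv : v = fun x => R ^ (-β) - (R + δ x) ^ (-β))
    (C : ℝ) (hC : C = (R / (R + Metric.diam Ω)) ^ (p * max β 1)) :
    (∀ x ∈ Ω, DifferentiableAt ℝ δ x → ‖gradient δ x‖ = 1 →
      ((1 ≤ β →
          (1 / δ x) * (R / (R + δ x)) ^ β ≤ ‖gradient v x‖ / v x) ∧
       (β < 1 →
          (1 / δ x) * (R / (R + δ x)) ≤ ‖gradient v x‖ / v x))) ∧
    (∀ᵐ x ∂volume, x ∈ Ω →
      C / δ x ^ p ≤ (‖gradient v x‖ / v x) ^ p) := by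
  have hβ0 : 0 < β := by rw [hβ]; exact div_pos (by linarith) (by linarith)
  have : NeZero n := ⟨hn.ne'⟩
  have hfne : (frontier Ω).Nonempty := by
    rw [nonempty_frontier_iff]
    refine ⟨hΩne, fun h => ?_⟩
    rw [h] at hΩb
    exact NormedSpace.unbounded_univ ℝ (EuclideanSpace ℝ (Fin n)) hΩb
  have hpos : ∀ x ∈ Ω, 0 < δ x := by
    intro x hx
    rw [hδ]
    refine (isClosed_frontier.notMem_iff_infDist_pos hfne).1 fun h => ?_
    rw [hΩo.frontier_eq] at h
    exact h.2 hx
  have hmain : ∀ x ∈ Ω, DifferentiableAt ℝ δ x → ‖gradient δ x‖ = 1 →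
      (1 / δ x) * (R / (R + δ x)) ^ (max β 1) ≤ ‖gradient v x‖ / v x := by
    intro x hx hd h1
    have h := (aux_real R (δ x) β hR (hpos x hx) hβ0).2
    rw [hv, aux_grad_v δ x R β hR hβ0 (hpos x hx) hd h1]
    exact h
  refine ⟨fun x hx hd h1 => ⟨fun hb => ?_, fun hb => ?_⟩, ?_⟩
  · simpa [max_eq_left hb] using hmain x hx hd h1
  · simpa [max_eq_right hb.le] using hmain x hx hd h1
  · have hlip : LipschitzWith 1 δ := by rw [hδ]; exact lipschitz_infDist_pt _
    filter_upwards [hlip.ae_differentiableAt (μ := volume)] with x hd hx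
    obtain ⟨y, hy, hxy⟩ := isClosed_frontier.exists_infDist_eq_dist hfne x
    have hp := hpos x hx
    have h1 : ‖gradient δ x‖ = 1 := by
      subst hδ
      exact aux_grad_dist _ x y hy hxy hp hd
    have hdiam : δ x ≤ diam Ω := by
      rw [hδ]
      simp only [hxy]
      rw [← diam_closure]
      exact dist_le_diam_of_mem hΩb.closure (subset_closure hx) (frontier_subset_closure hy)
    have h := hmain x hx hd h1
    have h0 : 0 < R / (R + δ x) := by positivity
    have hD : 0 < R + diam Ω := by linarith
    refine le_trans ?_ (Real.rpow_le_rpow (by positivity) h (by linarith))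
    rw [Real.mul_rpow (by positivity) (by positivity), ← Real.rpow_mul h0.le,
      Real.div_rpow zero_le_one hp.le, Real.one_rpow, hC, mul_comm p, div_eq_mul_one_div, mul_comm]
    refine mul_le_mul_of_nonneg_left ?_ (by positivity)
    refine Real.rpow_le_rpow (by positivity) ?_ (by positivity)
    exact div_le_div_of_nonneg_left hR.le (by positivity) (by linarith)
end

section
/- Let 1 < p < n and let Ω ⊆ ℝⁿ be a bounded nonempty open set satisfying the exterior sphere condition with radius R > 0 (for every ξ ∈ ∂Ω there exists y with dist(y, closure(Ω)) ≥ R and |ξ − y| = R). Set β = (n − p)/(p − 1). Then the Hardy inequality ∫_Ω |ζ(x)/δ(x)|^p dx ≤ C_Ω ∫_Ω |∇ζ(x)|^p dx holds for all smooth ζ with compact support in Ω, with constant C_Ω = (p/(p−1))^p · ((R + diam Ω)/R)^{p·max(β,1)}, where δ(x) = dist(x, ∂Ω) and diam Ω is the diameter of Ω. -/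
open MeasureTheory Metric Set

/-- the weight -/
noncomputable def hwt (R m r : ℝ) : ℝ := (R / r) ^ m / (r - R)

lemma hwt_le (R β r : ℝ) (hR : 0 < R) (hβ : 0 < β) (hr : R < r) :
    hwt R (max β 1) r ≤ β * r ^ (-β - 1) / (R ^ (-β) - r ^ (-β)) := by
  have hr0 : 0 < r := hR.trans hr
  set s := R / r with hs
  have hs0 : 0 < s := by positivity
  have hs1 : s < 1 := by rw [hs, div_lt_one hr0]; exact hr
  have hsβ : s ^ β < 1 := Real.rpow_lt_one hs0.le hs1 hβ
  have hRe : R = s * r := by rw [hs]; field_simp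
  have hR' : R ^ (-β) = (s ^ β)⁻¹ * r ^ (-β) := by
    rw [hRe, Real.mul_rpow hs0.le hr0.le, Real.rpow_neg hs0.le]
  have hrp : 0 < r ^ (-β) := by positivity
  have hsp : 0 < s ^ β := by positivity
  have e : β * r ^ (-β - 1) / (R ^ (-β) - r ^ (-β)) = β * s ^ β / ((1 - s ^ β) * r) := by
    rw [hR', Real.rpow_sub_one hr0.ne']
    have : 1 - s ^ β ≠ 0 := by linarith
    have h2 : (s ^ β)⁻¹ * r ^ (-β) - r ^ (-β) = r ^ (-β) * (1 - s ^ β) / s ^ β := by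
      field_simp
    rw [h2]
    field_simp
  rw [e]
  unfold hwt
  rw [← hs]
  have h3 : r - R = (1 - s) * r := by rw [hRe]; ring
  rw [h3, div_le_div_iff₀ (by nlinarith) (by nlinarith)]
  suffices h : s ^ (max β 1) * (1 - s ^ β) ≤ β * s ^ β * (1 - s) by nlinarith
  rcases le_total 1 β with h1 | h1
  · rw [max_eq_left h1]
    have := one_add_mul_self_le_rpow_one_add (s := s - 1) (by linarith) h1
    rw [add_sub_cancel] at this
    nlinarith
  · rw [max_eq_right h1, Real.rpow_one]
    have := Real.geom_mean_le_arith_mean2_weighted (w₁ := β) (w₂ := 1 - β) (p₁ := 1) (p₂ := s)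
      hβ.le (by linarith) (by norm_num) hs0.le (by ring)
    rw [Real.one_rpow, Real.rpow_sub hs0, Real.rpow_one, one_mul, div_le_iff₀ hsp] at this
    nlinarith

lemma hardy_pt (p g A b X u v : ℝ) (hp : 1 < p) (hg : 0 ≤ g) (hA : 0 ≤ A) (hb : 0 ≤ b)
    (hu : 0 < u) (hv : 0 < v) (hX : X ≤ A ^ (p - 1) * b) :
    g * (A * (v / u)) ^ p ≤ (p / (p - 1)) ^ p * (g * b ^ p) - (p / (p - 1)) * (g * v ^ (p - 1)) *
      (p * X * u ^ (1 - p) - (p - 1) * A ^ p * u ^ (-p) * v) := by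
  have hp0 : 0 < p := by linarith
  have hp1 : 0 < p - 1 := by linarith
  set κ := p / (p - 1) with hκ
  have hκ0 : 0 < κ := by positivity
  set a := A * (v / u) with ha
  have ha0 : 0 ≤ a := by positivity
  have e1 : v ^ (p - 1) * (A ^ p * u ^ (-p) * v) = a ^ p := by
    rw [ha, Real.mul_rpow hA (by positivity), Real.div_rpow hv.le hu.le, Real.rpow_neg hu.le,
      Real.rpow_sub_one hv.ne']
    field_simp
  have e2 : v ^ (p - 1) * (A ^ (p - 1) * b * u ^ (1 - p)) = a ^ (p - 1) * b := by
    rw [ha, Real.mul_rpow hA (by positivity), Real.div_rpow hv.le hu.le,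
      show 1 - p = -(p - 1) by ring, Real.rpow_neg hu.le]
    field_simp
  have hc : p.HolderConjugate κ := by
    rw [Real.holderConjugate_iff]
    refine ⟨hp, ?_⟩
    rw [hκ]; field_simp; ring
  have y := Real.young_inequality_of_nonneg (a := κ * b) (b := a ^ (p - 1)) (by positivity)
    (by positivity) hc
  rw [← Real.rpow_mul ha0, show (p - 1) * κ = p by rw [hκ]; field_simp,
    Real.mul_rpow hκ0.le hb] at y
  have y2 : p * (κ * b * a ^ (p - 1)) ≤ κ ^ p * b ^ p + (p - 1) * a ^ p := by
    calc _ ≤ p * (κ ^ p * b ^ p / p + a ^ p / κ) := by gcongr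
      _ = _ := by rw [hκ]; field_simp
  have hX2 : v ^ (p - 1) * (X * u ^ (1 - p)) ≤ a ^ (p - 1) * b := by
    rw [← e2]; gcongr
  have hκp : κ * (p - 1) = p := by rw [hκ]; field_simp
  have key : a ^ p ≤ κ ^ p * b ^ p - κ * p * (v ^ (p - 1) * (X * u ^ (1 - p)))
      + κ * (p - 1) * a ^ p := by
    have : κ * p * (v ^ (p - 1) * (X * u ^ (1 - p))) ≤ κ * p * (a ^ (p - 1) * b) := by gcongr
    rw [hκp]
    nlinarith
  calc g * a ^ p ≤ g * (κ ^ p * b ^ p - κ * p * (v ^ (p - 1) * (X * u ^ (1 - p)))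
      + κ * (p - 1) * a ^ p) := by gcongr
    _ = _ := by rw [← e1]; ring

lemma hardy_1d (n : ℕ) (p : ℝ) (hp1 : 1 < p) (hpn : p < n) (R : ℝ) (hR : 0 < R)
    (β : ℝ) (hβ : β = (n - p) / (p - 1)) (f f' : ℝ → ℝ) (hf : ∀ r, HasDerivAt f (f' r) r)
    (hf' : Continuous f') (a L : ℝ) (ha : R < a) (hfa : f a = 0) (hL : a ≤ L) :
    IntervalIntegrable (fun r => r ^ (n - 1) * (|f r| * hwt R (max β 1) r) ^ p) volume a L ∧
    IntervalIntegrable (fun r => (p / (p - 1)) ^ p * (r ^ (n - 1) * |f' r| ^ p)) volume a L ∧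
    ∫ r in a..L, r ^ (n - 1) * (|f r| * hwt R (max β 1) r) ^ p ≤
      ∫ r in a..L, (p / (p - 1)) ^ p * (r ^ (n - 1) * |f' r| ^ p) := by
  have hp1' : 0 < p - 1 := by linarith
  have hβ0 : 0 < β := by rw [hβ]; exact div_pos (by linarith) hp1'
  have hn : 1 ≤ n := by
    rcases Nat.eq_zero_or_pos n with h | h
    · subst h; norm_num at hpn; linarith
    · exact h
  have hfc : Continuous f := continuous_iff_continuousAt.2 fun r => (hf r).continuousAt
  set κ := p / (p - 1) with hκ
  have hκ0 : 0 < κ := div_pos (by linarith) hp1'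
  set u : ℝ → ℝ := fun r => R ^ (-β) - r ^ (-β) with hu
  set v : ℝ → ℝ := fun r => β * r ^ (-β - 1) with hv
  have hu' : ∀ r, 0 < r → HasDerivAt u (v r) r := by
    intro r hr
    have := (Real.hasDerivAt_rpow_const (x := r) (p := -β) (Or.inl hr.ne')).const_sub (R ^ (-β))
    refine HasDerivAt.congr_deriv this ?_
    simp only [hv]; ring
  have hupos : ∀ r, R < r → 0 < u r := by
    intro r hr
    simp only [hu, sub_pos]
    exact Real.rpow_lt_rpow_of_neg hR hr (by linarith)
  have hvpos : ∀ r, R < r → 0 < v r := by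
    intro r hr
    have : 0 < r := hR.trans hr
    simp only [hv]; positivity
  have hc : ∀ r, R < r → r ^ (n - 1) * v r ^ (p - 1) = β ^ (p - 1) := by
    intro r hr
    have h0 : 0 < r := hR.trans hr
    simp only [hv]
    rw [Real.mul_rpow hβ0.le (by positivity), ← Real.rpow_mul h0.le, ← Real.rpow_natCast r,
      mul_left_comm, ← Real.rpow_add h0]
    have : ((n - 1 : ℕ) : ℝ) + (-β - 1) * (p - 1) = 0 := by
      rw [Nat.cast_sub hn, hβ]; field_simp; push_cast; ring
    rw [this]; simp
  set D : ℝ → ℝ := fun r => |f r| ^ p * u r ^ (1 - p) with hD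
  set D' : ℝ → ℝ := fun r => p * (|f r| ^ (p - 2) * f r * f' r) * u r ^ (1 - p)
      - (p - 1) * |f r| ^ p * u r ^ (-p) * v r with hD'
  have hDd : ∀ r, R < r → HasDerivAt D (D' r) r := by
    intro r hr
    have h1 := (hasDerivAt_abs_rpow (f r) hp1).comp r (hf r)
    have h2 := (hu' r (hR.trans hr)).rpow_const (p := 1 - p) (Or.inl (hupos r hr).ne')
    have := h1.mul h2
    refine HasDerivAt.congr_deriv this ?_
    simp only [hD', Function.comp]
    rw [show 1 - p - 1 = -p by ring]; ring
  have hsub : ∀ r ∈ uIcc a L, R < r := by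
    intro r hr
    rw [uIcc_of_le hL] at hr
    exact ha.trans_le hr.1
  have hpc : Continuous fun x : ℝ => |x| ^ (p - 2) * x := by
    have h := (contDiff_norm_rpow (E := ℝ) hp1).continuous_deriv le_rfl
    have e : deriv (fun x : ℝ => ‖x‖ ^ p) = fun x : ℝ => p * |x| ^ (p - 2) * x :=
      funext fun x => (hasDerivAt_norm_rpow x hp1).deriv
    rw [e] at h
    have h2 := h.const_mul p⁻¹
    refine h2.congr fun x => ?_
    field_simp
  have hucont : ContinuousOn u (uIcc a L) := fun r hr =>
    (hu' r (hR.trans (hsub r hr))).continuousAt.continuousWithinAt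
  have hvcont : ContinuousOn v (uIcc a L) := by
    apply ContinuousOn.mul continuousOn_const
    exact ContinuousOn.rpow_const continuousOn_id fun r hr => Or.inl (hR.trans (hsub r hr)).ne'
  have hD'c : ContinuousOn D' (uIcc a L) := by
    apply ContinuousOn.sub
    · apply ContinuousOn.mul
      · exact (continuous_const.mul ((hpc.comp hfc).mul hf')).continuousOn
      · exact hucont.rpow_const fun r hr => Or.inl (hupos r (hsub r hr)).ne'
    · apply ContinuousOn.mul _ hvcont
      apply ContinuousOn.mul
      · exact (continuous_const.mul (hfc.abs.rpow_const fun r => Or.inr (by linarith))).continuousOn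
      · exact hucont.rpow_const fun r hr => Or.inl (hupos r (hsub r hr)).ne'
  have hD'i : IntervalIntegrable D' volume a L := hD'c.intervalIntegrable
  have hFTC := intervalIntegral.integral_eq_sub_of_hasDerivAt (fun r hr => hDd r (hsub r hr)) hD'i
  have hDa : D a = 0 := by simp [hD, hfa, Real.zero_rpow (by linarith : p ≠ 0)]
  have hDL : 0 ≤ D L := by
    have := hupos L (ha.trans_le hL)
    simp only [hD]; positivity
  have hi2 : IntervalIntegrable (fun r => κ ^ p * (r ^ (n - 1) * |f' r| ^ p)) volume a L := by
    apply Continuous.intervalIntegrable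
    exact continuous_const.mul ((continuous_pow _).mul
      (hf'.abs.rpow_const fun r => Or.inr (by linarith)))
  have hi1 : IntervalIntegrable (fun r => r ^ (n - 1) * (|f r| * hwt R (max β 1) r) ^ p)
      volume a L := by
    apply ContinuousOn.intervalIntegrable
    apply ContinuousOn.mul (continuous_pow _).continuousOn
    apply ContinuousOn.rpow_const _ fun r hr => Or.inr (by linarith)
    apply hfc.abs.continuousOn.mul
    unfold hwt
    apply ContinuousOn.div
    · apply ContinuousOn.rpow_const
      · exact continuousOn_const.div continuousOn_id fun r hr => (hR.trans (hsub r hr)).ne'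
      · intro r hr
        left
        exact (div_pos hR (hR.trans (hsub r hr))).ne'
    · exact (continuous_id.sub continuous_const).continuousOn
    · intro r hr
      exact (sub_pos.2 (hsub r hr)).ne'
  have hi3 : IntervalIntegrable (fun r => κ * β ^ (p - 1) * D' r) volume a L := hD'i.const_mul _
  refine ⟨hi1, hi2, ?_⟩
  calc _ ≤ ∫ r in a..L, (κ ^ p * (r ^ (n - 1) * |f' r| ^ p) - κ * β ^ (p - 1) * D' r) := by
        apply intervalIntegral.integral_mono_on hL hi1 (hi2.sub hi3)
        intro r hr
        have hr' := hsub r (by rwa [uIcc_of_le hL])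
        have h0 : 0 < r := hR.trans hr'
        rw [← hc r hr']
        refine le_trans ?_ (hardy_pt p (r ^ (n - 1)) |f r| |f' r| (|f r| ^ (p - 2) * f r * f' r)
          (u r) (v r) hp1 (by positivity) (abs_nonneg _) (abs_nonneg _) (hupos r hr')
          (hvpos r hr') ?_)
        · have h1 := hwt_le R β r hR hβ0 hr'
          have h2 : 0 ≤ hwt R (max β 1) r := by
            unfold hwt
            have : 0 < r - R := by linarith
            positivity
          gcongr
        · rcases eq_or_ne (f r) 0 with h | h
          · simp [h, Real.zero_rpow hp1'.ne']
          · have : |f r| ^ (p - 1) = |f r| ^ (p - 2) * |f r| := by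
              rw [← Real.rpow_add_one (abs_pos.2 h).ne']; ring_nf
            rw [this, mul_assoc, mul_assoc, ← abs_mul]
            gcongr
            exact le_abs_self _
    _ = (∫ r in a..L, κ ^ p * (r ^ (n - 1) * |f' r| ^ p)) - κ * β ^ (p - 1) * (D L - D a) := by
        rw [intervalIntegral.integral_sub hi2 hi3, intervalIntegral.integral_const_mul (κ * _), hFTC]
    _ ≤ _ := by
        rw [hDa, sub_zero]
        have : 0 ≤ κ * β ^ (p - 1) * D L := by positivity
        linarith

open scoped ENNReal

lemma lint_down (g h : ℝ → ℝ≥0∞) (S : Set ℝ) (M : ℝ) (hM : ∀ r, M < r → g r = 0)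
    (hS0 : S ⊆ Ioi 0) (hS : ∀ r ∈ S, ∀ s, 0 < s → s ≤ r → s ∈ S)
    (hgh : ∀ L, ∫⁻ r in Ioc 0 L, g r ≤ ∫⁻ r in Ioc 0 L, h r) :
    ∫⁻ r in S, g r ≤ ∫⁻ r in S, h r := by
  have h1 : ∫⁻ r in S, g r ≤ ∫⁻ r in S ∩ Iic M, g r := by
    have hs : S ⊆ (S ∩ Iic M) ∪ Ioi M := by
      intro r hr
      rcases le_or_gt r M with h | h
      · exact Or.inl ⟨hr, h⟩
      · exact Or.inr h
    have hz : ∫⁻ r in Ioi M, g r = 0 := by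
      rw [setLIntegral_congr_fun measurableSet_Ioi (g := fun _ => 0) (fun r hr => hM r hr)]
      simp
    calc _ ≤ ∫⁻ r in (S ∩ Iic M) ∪ Ioi M, g r := lintegral_mono_set hs
      _ ≤ _ := lintegral_union_le _ _ _
      _ = _ := by rw [hz, add_zero]
  refine h1.trans ?_
  rcases (S ∩ Iic M).eq_empty_or_nonempty with he | hne
  · simp [he]
  have hbd : BddAbove (S ∩ Iic M) := ⟨M, fun r hr => hr.2⟩
  set L := sSup (S ∩ Iic M)
  calc ∫⁻ r in S ∩ Iic M, g r ≤ ∫⁻ r in Ioc 0 L, g r :=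
        lintegral_mono_set fun r hr => ⟨hS0 hr.1, le_csSup hbd hr⟩
    _ ≤ ∫⁻ r in Ioc 0 L, h r := hgh L
    _ = ∫⁻ r in Ioo 0 L, h r := setLIntegral_congr Ioo_ae_eq_Ioc.symm
    _ ≤ _ := by
      apply lintegral_mono_set
      intro r hr
      obtain ⟨t, ht, hrt⟩ := exists_lt_of_lt_csSup hne hr.2
      exact hS t ht.1 r hr.1 hrt.le

lemma hardy_1d_lint (n : ℕ) (p : ℝ) (hp1 : 1 < p) (hpn : p < n) (R : ℝ) (hR : 0 < R)
    (β : ℝ) (hβ : β = (n - p) / (p - 1)) (f f' : ℝ → ℝ) (hf : ∀ r, HasDerivAt f (f' r) r)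
    (hf' : Continuous f') (a : ℝ) (ha : R < a) (hfa : ∀ r, 0 < r → r ≤ a → f r = 0) (L : ℝ) :
    ∫⁻ r in Ioc 0 L, ENNReal.ofReal (r ^ (n - 1) * (|f r| * hwt R (max β 1) r) ^ p) ≤
      ∫⁻ r in Ioc 0 L, ENNReal.ofReal ((p / (p - 1)) ^ p * (r ^ (n - 1) * |f' r| ^ p)) := by
  have hz : ∫⁻ r in Ioc 0 a, ENNReal.ofReal (r ^ (n - 1) * (|f r| * hwt R (max β 1) r) ^ p) = 0 := by
    rw [setLIntegral_congr_fun measurableSet_Ioc (g := fun _ => 0) (fun r hr => ?_)]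
    · simp
    · simp [hfa r hr.1 hr.2, Real.zero_rpow (by linarith : p ≠ 0)]
  rcases le_total L a with hL | hL
  · refine le_trans (lintegral_mono_set (Ioc_subset_Ioc_right hL)) ?_
    rw [hz]; exact zero_le
  obtain ⟨i1, i2, hle⟩ := hardy_1d n p hp1 hpn R hR β hβ f f' hf hf' a L ha
    (hfa a (hR.trans ha) le_rfl) hL
  have ha0 : 0 < a := hR.trans ha
  have hp' : 0 ≤ p / (p - 1) := div_nonneg (by linarith) (by linarith)
  rw [intervalIntegral.integral_of_le hL, intervalIntegral.integral_of_le hL] at hle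
  calc _ ≤ ∫⁻ r in Ioc 0 a ∪ Ioc a L,
        ENNReal.ofReal (r ^ (n - 1) * (|f r| * hwt R (max β 1) r) ^ p) :=
        lintegral_mono_set Ioc_subset_Ioc_union_Ioc
    _ ≤ _ := lintegral_union_le _ _ _
    _ = ∫⁻ r in Ioc a L, ENNReal.ofReal (r ^ (n - 1) * (|f r| * hwt R (max β 1) r) ^ p) := by
        rw [hz, zero_add]
    _ = ENNReal.ofReal (∫ r in Ioc a L, r ^ (n - 1) * (|f r| * hwt R (max β 1) r) ^ p) := by
        rw [ofReal_integral_eq_lintegral_ofReal i1.1]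
        filter_upwards [ae_restrict_mem measurableSet_Ioc] with r hr
        have h1 : 0 < r := ha0.trans hr.1
        have h2 : 0 ≤ hwt R (max β 1) r := by
          unfold hwt
          have : 0 < r - R := by linarith [hr.1]
          positivity
        simp only [Pi.zero_apply]
        positivity
    _ ≤ ENNReal.ofReal (∫ r in Ioc a L, (p / (p - 1)) ^ p * (r ^ (n - 1) * |f' r| ^ p)) :=
        ENNReal.ofReal_le_ofReal hle
    _ = ∫⁻ r in Ioc a L, ENNReal.ofReal ((p / (p - 1)) ^ p * (r ^ (n - 1) * |f' r| ^ p)) := by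
        rw [ofReal_integral_eq_lintegral_ofReal i2.1]
        filter_upwards [ae_restrict_mem measurableSet_Ioc] with r hr
        have h1 : 0 < r := ha0.trans hr.1
        simp only [Pi.zero_apply]
        positivity
    _ ≤ _ := lintegral_mono_set (Ioc_subset_Ioc_left ha0.le)

lemma polar_lint (n : ℕ) (hn : 0 < n) (y : EuclideanSpace ℝ (Fin n))
    (F : EuclideanSpace ℝ (Fin n) → ℝ≥0∞) (hF : Measurable F) :
    ∫⁻ x, F x = ∫⁻ ω : sphere (0 : EuclideanSpace ℝ (Fin n)) 1,
      ∫⁻ r in Ioi (0 : ℝ), ENNReal.ofReal (r ^ (n - 1)) * F (y + r • (ω : EuclideanSpace ℝ (Fin n)))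
      ∂(volume : Measure ℝ) ∂(volume : Measure (EuclideanSpace ℝ (Fin n))).toSphere := by
  have : Nonempty (Fin n) := ⟨⟨0, hn⟩⟩
  have hmp := (volume : Measure (EuclideanSpace ℝ (Fin n))).measurePreserving_homeomorphUnitSphereProd
  have hsm := hmp.symm (homeomorphUnitSphereProd (EuclideanSpace ℝ (Fin n))).toMeasurableEquiv
  have hG : Measurable fun x => F (y + x) := hF.comp (measurable_const_add y)
  calc ∫⁻ x, F x = ∫⁻ x, F (y + x) := (lintegral_add_left_eq_self F y).symm
    _ = ∫⁻ x in {0}ᶜ, F (y + x) := by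
        rw [Measure.restrict_eq_self_of_ae_mem]
        simp [ae_iff]
    _ = ∫⁻ x : ({0}ᶜ : Set (EuclideanSpace ℝ (Fin n))), F (y + x.1) ∂(volume.comap Subtype.val) :=
        (lintegral_subtype_comap (measurableSet_singleton _).compl _).symm
    _ = ∫⁻ z, F (y + ((homeomorphUnitSphereProd (EuclideanSpace ℝ (Fin n))).symm z :
          EuclideanSpace ℝ (Fin n)))
          ∂((volume : Measure (EuclideanSpace ℝ (Fin n))).toSphere.prod
            (Measure.volumeIoiPow (n - 1))) := by
        have := hsm.lintegral_comp (hG.comp measurable_subtype_coe)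
        simp only [finrank_euclideanSpace, Fintype.card_fin] at this
        exact this.symm
    _ = _ := by
        rw [lintegral_prod]
        · refine lintegral_congr fun ω => ?_
          rw [Measure.volumeIoiPow, lintegral_withDensity_eq_lintegral_mul₀]
          · rw [← lintegral_subtype_comap measurableSet_Ioi]
            rfl
          · fun_prop
          · apply Measurable.aemeasurable
            apply hG.comp
            apply measurable_subtype_coe.comp
            exact (homeomorphUnitSphereProd (EuclideanSpace ℝ (Fin n))).symm.measurable.comp
              measurable_prodMk_left
        · apply Measurable.aemeasurable
          apply hG.comp
          apply measurable_subtype_coe.comp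
          exact (homeomorphUnitSphereProd (EuclideanSpace ℝ (Fin n))).symm.measurable

lemma measurable_hwt (R m : ℝ) : Measurable (hwt R m) := by
  unfold hwt; fun_prop

lemma hardy_cell (n : ℕ) (hn : 0 < n) (p : ℝ) (hp1 : 1 < p) (hpn : p < n) (R : ℝ) (hR : 0 < R)
    (β : ℝ) (hβ : β = (n - p) / (p - 1))
    (ζ : EuclideanSpace ℝ (Fin n) → ℝ)
    (hζ : ContDiff ℝ (⊤ : ℕ∞) ζ) (hζc : HasCompactSupport ζ)
    (y : EuclideanSpace ℝ (Fin n)) (a : ℝ) (ha : R < a) (hy : ∀ x, dist x y ≤ a → ζ x = 0)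
    (V : Set (EuclideanSpace ℝ (Fin n))) (hV : MeasurableSet V)
    (hstar : ∀ x ∈ V, ∀ s : ℝ, 0 < s → s ≤ 1 → y + s • (x - y) ∈ V) :
    ∫⁻ x in V, ENNReal.ofReal ((|ζ x| * hwt R (max β 1) (dist x y)) ^ p) ≤
      ∫⁻ x in V, ENNReal.ofReal ((p / (p - 1)) ^ p * ‖gradient ζ x‖ ^ p) := by
  have hgc : Continuous (gradient ζ) := by
    unfold gradient
    exact (LinearIsometryEquiv.continuous _).comp (hζ.continuous_fderiv (by simp))
  have hm1 : Measurable fun x => ENNReal.ofReal ((|ζ x| * hwt R (max β 1) (dist x y)) ^ p) := by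
    have := measurable_hwt R (max β 1)
    have h2 := hζ.continuous.measurable
    fun_prop
  have hm2 : Measurable fun x => ENNReal.ofReal ((p / (p - 1)) ^ p * ‖gradient ζ x‖ ^ p) := by
    have := hgc.measurable
    fun_prop
  rw [← lintegral_indicator hV, ← lintegral_indicator hV,
    polar_lint n hn y _ (hm1.indicator hV), polar_lint n hn y _ (hm2.indicator hV)]
  refine lintegral_mono fun ω => ?_
  set w : EuclideanSpace ℝ (Fin n) := ω.1 with hw
  have hw1 : ‖w‖ = 1 := by simp [hw]
  have hcont : Continuous fun r : ℝ => y + r • w := by fun_prop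
  set S : Set ℝ := {r | 0 < r ∧ y + r • w ∈ V} with hS
  have hSm : MeasurableSet {r : ℝ | y + r • w ∈ V} := hcont.measurable hV
  have conv : ∀ G : EuclideanSpace ℝ (Fin n) → ℝ≥0∞,
      ∫⁻ r in Ioi (0 : ℝ), ENNReal.ofReal (r ^ (n - 1)) * V.indicator G (y + r • w) =
      ∫⁻ r in S, ENNReal.ofReal (r ^ (n - 1)) * G (y + r • w) := by
    intro G
    have : S = {r : ℝ | y + r • w ∈ V} ∩ Ioi 0 := by
      ext r; simp [hS, and_comm]
    rw [this, ← Measure.restrict_restrict hSm, ← lintegral_indicator hSm]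
    refine lintegral_congr fun r => ?_
    by_cases h : y + r • w ∈ V <;> simp [h]
  rw [conv, conv]
  set f : ℝ → ℝ := fun r => ζ (y + r • w) with hf
  set f' : ℝ → ℝ := fun r => fderiv ℝ ζ (y + r • w) w with hf'
  have hfd : ∀ r, HasDerivAt f (f' r) r := by
    intro r
    have h1 : HasFDerivAt ζ (fderiv ℝ ζ (y + r • w)) (y + r • w) :=
      (hζ.differentiable (by simp) _).hasFDerivAt
    have h2 : HasDerivAt (fun r : ℝ => y + r • w) w r := by
      simpa using ((hasDerivAt_id r).smul_const w).const_add y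
    exact h1.comp_hasDerivAt r h2
  have hf'c : Continuous f' := by
    have := (hζ.continuous_fderiv (by simp)).comp hcont
    exact this.clm_apply continuous_const
  have hdist : ∀ r, 0 < r → dist (y + r • w) y = r := by
    intro r hr
    simp [norm_smul, hw1, abs_of_pos hr]
  have hf'le : ∀ r, |f' r| ≤ ‖gradient ζ (y + r • w)‖ := by
    intro r
    have h1 := (fderiv ℝ ζ (y + r • w)).le_opNorm w
    rw [hw1, mul_one] at h1
    have : ‖gradient ζ (y + r • w)‖ = ‖fderiv ℝ ζ (y + r • w)‖ := by
      unfold gradient; exact LinearIsometryEquiv.norm_map _ _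
    rw [this]; exact h1
  have hp' : 0 ≤ p / (p - 1) := div_nonneg (by linarith) (by linarith)
  have hS0 : S ⊆ Ioi 0 := fun r hr => hr.1
  have hSm' : MeasurableSet S := measurableSet_Ioi.inter hSm
  obtain ⟨M, hM⟩ := hζc.isBounded.subset_closedBall y
  calc ∫⁻ r in S, ENNReal.ofReal (r ^ (n - 1)) *
        ENNReal.ofReal ((|ζ (y + r • w)| * hwt R (max β 1) (dist (y + r • w) y)) ^ p)
      = ∫⁻ r in S, ENNReal.ofReal (r ^ (n - 1) * (|f r| * hwt R (max β 1) r) ^ p) := by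
        refine setLIntegral_congr_fun hSm' fun r hr => ?_
        have : 0 < r := hr.1
        rw [hdist r hr.1, ENNReal.ofReal_mul (by positivity)]
    _ ≤ ∫⁻ r in S, ENNReal.ofReal ((p / (p - 1)) ^ p * (r ^ (n - 1) * |f' r| ^ p)) := by
        apply lint_down _ _ S (max M 0) _ hS0
        · intro r hr s hs hsr
          refine ⟨hs, ?_⟩
          have hr0 : 0 < r := hr.1
          have := hstar _ hr.2 (s / r) (by positivity) ((div_le_one hr0).2 hsr)
          rw [add_sub_cancel_left, smul_smul, div_mul_cancel₀ _ hr0.ne'] at this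
          exact this
        · exact hardy_1d_lint n p hp1 hpn R hR β hβ f f' hfd hf'c a ha
            fun r hr hra => hy _ (by rw [hdist r hr]; exact hra)
        · intro r hr
          have hr0 : 0 < r := (le_max_right _ _).trans_lt hr
          have : f r = 0 := by
            show ζ (y + r • w) = 0
            apply image_eq_zero_of_notMem_tsupport
            intro hmem
            have := hM hmem
            rw [mem_closedBall, hdist r hr0] at this
            exact absurd ((le_max_left _ _).trans_lt hr) (not_lt.2 this)
          simp [this, Real.zero_rpow (by linarith : p ≠ 0)]
    _ ≤ _ := by
        refine setLIntegral_mono' hSm' fun r hr => ?_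
        have h0 : 0 < r := hr.1
        rw [← ENNReal.ofReal_mul (by positivity)]
        apply ENNReal.ofReal_le_ofReal
        rw [mul_left_comm]
        have := hf'le r
        gcongr

/-- distance to the first `N + 1` points -/
noncomputable def dN {n : ℕ} (y : ℕ → EuclideanSpace ℝ (Fin n)) (N : ℕ)
    (x : EuclideanSpace ℝ (Fin n)) : ℝ :=
  (Finset.range (N + 1)).inf' ⟨0, by simp⟩ fun i => dist x (y i)

/-- Voronoi cell with tie breaking -/
def vcell {n : ℕ} (y : ℕ → EuclideanSpace ℝ (Fin n)) (N i : ℕ) :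
    Set (EuclideanSpace ℝ (Fin n)) :=
  (⋂ j ∈ Finset.range (N + 1), {x | dist x (y i) ≤ dist x (y j)}) ∩
  (⋂ j ∈ Finset.range i, {x | dist x (y i) < dist x (y j)})

lemma hardy_dN (n : ℕ) (hn : 0 < n) (p : ℝ) (hp1 : 1 < p) (hpn : p < n) (R : ℝ) (hR : 0 < R)
    (β : ℝ) (hβ : β = (n - p) / (p - 1))
    (ζ : EuclideanSpace ℝ (Fin n) → ℝ)
    (hζ : ContDiff ℝ (⊤ : ℕ∞) ζ) (hζc : HasCompactSupport ζ)
    (y : ℕ → EuclideanSpace ℝ (Fin n)) (a : ℝ) (ha : R < a)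
    (hy : ∀ i x, dist x (y i) ≤ a → ζ x = 0) (N : ℕ) :
    ∫⁻ x, ENNReal.ofReal ((|ζ x| * hwt R (max β 1) (dN y N x)) ^ p) ≤
      ∫⁻ x, ENNReal.ofReal ((p / (p - 1)) ^ p * ‖gradient ζ x‖ ^ p) := by
  have hmeas : ∀ i, MeasurableSet (vcell y N i) := by
    intro i
    apply MeasurableSet.inter
    · exact Finset.measurableSet_biInter _ fun j _ =>
        measurableSet_le (by fun_prop) (by fun_prop)
    · exact Finset.measurableSet_biInter _ fun j _ =>
        measurableSet_lt (by fun_prop) (by fun_prop)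
  have hdisj : (↑(Finset.range (N + 1)) : Set ℕ).PairwiseDisjoint (vcell y N) := by
    have key : ∀ i ∈ Finset.range (N + 1), ∀ j ∈ Finset.range (N + 1), i < j → Disjoint (vcell y N i) (vcell y N j) := by
      intro i hi j hj hij
      rw [Set.disjoint_left]
      rintro x hx hx'
      simp only [vcell, mem_inter_iff, mem_iInter, mem_ofPred_eq, Finset.mem_range] at hx hx'
      exact absurd (hx'.2 i hij) (not_lt.2 (hx.1 j (Finset.mem_range.1 hj)))
    intro i hi j hj hij
    rcases lt_or_gt_of_ne hij with h | h
    · exact key i hi j hj h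
    · exact (key j hj i hi h).symm
  have hcov : (⋃ i ∈ Finset.range (N + 1), vcell y N i) = univ := by
    rw [eq_univ_iff_forall]
    intro x
    have hex : ∃ i, i ∈ Finset.range (N + 1) ∧ dN y N x = dist x (y i) :=
      Finset.exists_mem_eq_inf' _ _
    classical
    obtain ⟨h1, h2⟩ := Nat.find_spec hex
    have hmin : ∀ j, j < N + 1 → dN y N x ≤ dist x (y j) := fun j hj =>
      Finset.inf'_le _ (Finset.mem_range.2 hj)
    simp only [vcell, mem_iUnion, mem_inter_iff, mem_iInter, mem_ofPred_eq]
    refine ⟨Nat.find hex, h1, ?_, ?_⟩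
    · intro j hj
      rw [← h2]; exact hmin j (Finset.mem_range.1 hj)
    · intro j hj
      have hj' := Finset.mem_range.1 hj
      have hjN : j < N + 1 := hj'.trans (Finset.mem_range.1 h1)
      rw [← h2]
      refine lt_of_le_of_ne (hmin j hjN) fun he => Nat.find_min hex hj' ⟨Finset.mem_range.2 hjN, he⟩
  rw [← setLIntegral_univ, ← setLIntegral_univ (fun x => ENNReal.ofReal ((p / (p - 1)) ^ p * _)),
    ← hcov, lintegral_biUnion_finset hdisj (fun i _ => hmeas i),
    lintegral_biUnion_finset hdisj (fun i _ => hmeas i)]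
  refine Finset.sum_le_sum fun i hi => ?_
  have hcell : ∀ x ∈ vcell y N i, dN y N x = dist x (y i) := by
    intro x hx
    simp only [vcell, mem_inter_iff, mem_iInter, mem_ofPred_eq] at hx
    exact le_antisymm (Finset.inf'_le _ hi) (Finset.le_inf' _ _ hx.1)
  rw [setLIntegral_congr_fun (hmeas i)
    (g := fun x => ENNReal.ofReal ((|ζ x| * hwt R (max β 1) (dist x (y i))) ^ p))
    (fun x hx => by rw [hcell x hx])]
  refine hardy_cell n hn p hp1 hpn R hR β hβ ζ hζ hζc (y i) a ha (hy i) _ (hmeas i) ?_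
  intro x hx s hs0 hs1
  simp only [vcell, mem_inter_iff, mem_iInter, mem_ofPred_eq] at hx ⊢
  have e1 : dist (y i + s • (x - y i)) (y i) = s * dist x (y i) := by
    rw [dist_eq_norm, add_sub_cancel_left, norm_smul, Real.norm_of_nonneg hs0.le, dist_eq_norm]
  have e2 : dist x (y i + s • (x - y i)) = (1 - s) * dist x (y i) := by
    rw [dist_eq_norm, show x - (y i + s • (x - y i)) = (1 - s) • (x - y i) by module, norm_smul,
      Real.norm_of_nonneg (by linarith), dist_eq_norm]
  refine ⟨fun j hj => ?_, fun j hj => ?_⟩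
  · have := hx.1 j hj
    have h3 := dist_triangle x (y i + s • (x - y i)) (y j)
    linarith
  · have := hx.2 j hj
    have h3 := dist_triangle x (y i + s • (x - y i)) (y j)
    linarith

theorem hardy_exterior_sphere
    (n : ℕ) (hn : 0 < n) (p : ℝ) (hp1 : 1 < p) (hpn : p < n)
    (R : ℝ) (hR : 0 < R)
    (Ω : Set (EuclideanSpace ℝ (Fin n))) (hΩo : IsOpen Ω)
    (hΩne : Ω.Nonempty) (hΩb : Bornology.IsBounded Ω)
    (hext : ∀ ξ ∈ frontier Ω, ∃ y : EuclideanSpace ℝ (Fin n),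
      R ≤ Metric.infDist y (closure Ω) ∧ dist ξ y = R)
    (β : ℝ) (hβ : β = (n - p) / (p - 1))
    (ζ : EuclideanSpace ℝ (Fin n) → ℝ)
    (hζ : ContDiff ℝ (⊤ : ℕ∞) ζ) (hζc : HasCompactSupport ζ) (hζs : tsupport ζ ⊆ Ω) :
    ∫ x in Ω, |ζ x / Metric.infDist x (frontier Ω)| ^ p
      ≤ (p / (p - 1)) ^ p * ((R + Metric.diam Ω) / R) ^ (p * max β 1) *
        ∫ x in Ω, ‖gradient ζ x‖ ^ p := by
  have hp0 : 0 < p := by linarith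
  have hκ0 : 0 < p / (p - 1) := div_pos hp0 (by linarith)
  have : Nonempty (Fin n) := ⟨⟨0, hn⟩⟩
  have hgc : Continuous (gradient ζ) := by
    unfold gradient
    exact (LinearIsometryEquiv.continuous _).comp (hζ.continuous_fderiv (by simp))
  have hfrne : (frontier Ω).Nonempty := by
    rw [nonempty_iff_ne_empty]
    intro h
    rw [frontier_eq_empty_iff] at h
    rcases h with h | h
    · exact hΩne.ne_empty h
    · rw [h] at hΩb
      exact NormedSpace.unbounded_univ ℝ (EuclideanSpace ℝ (Fin n)) hΩb
  set m := max β 1 with hm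
  have hm0 : 0 < m := lt_of_lt_of_le one_pos (le_max_right _ _)
  set Y : Set (EuclideanSpace ℝ (Fin n)) := {y | R ≤ infDist y (closure Ω)} with hY
  have hYne : Y.Nonempty := by
    obtain ⟨ξ, hξ⟩ := hfrne
    obtain ⟨y, hy, _⟩ := hext ξ hξ
    exact ⟨y, hy⟩
  have hYΩ : ∀ y ∈ Y, ∀ x ∈ Ω, R ≤ dist x y := by
    intro y hy x hx
    rw [dist_comm]
    exact le_trans hy (infDist_le_dist_of_mem (subset_closure hx))
  obtain ⟨ε, hε, hεΩ⟩ := hζc.isCompact.exists_cthickening_subset_open hΩo hζs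
  have hgap : ∀ y ∈ Y, ∀ x ∈ tsupport ζ, R + min ε R ≤ dist x y := by
    intro y hy x hx
    have h1 := hYΩ y hy x (hζs hx)
    have hd : 0 < dist x y := by linarith
    set e := min ε R with he
    have he0 : 0 < e := lt_min hε hR
    have heR : e ≤ R := min_le_right _ _
    set z := x + (e / dist x y) • (y - x) with hz
    have hzx : dist z x ≤ ε := by
      rw [hz, dist_eq_norm, add_sub_cancel_left, norm_smul, Real.norm_of_nonneg (by positivity),
        ← dist_eq_norm, dist_comm y x, div_mul_cancel₀ _ hd.ne']
      exact min_le_left _ _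
    have hzΩ : z ∈ Ω := hεΩ (mem_cthickening_of_dist_le z x ε _ hx hzx)
    have hzy : dist z y = dist x y - e := by
      have h2 : z - y = (1 - e / dist x y) • (x - y) := by rw [hz]; module
      have h3 : e / dist x y ≤ 1 := (div_le_one hd).2 (by linarith)
      rw [dist_eq_norm z y, h2, norm_smul, Real.norm_of_nonneg (by linarith), ← dist_eq_norm]
      field_simp
    have := hYΩ y hy z hzΩ
    linarith
  set a := R + min ε R / 2 with ha
  have hmin : 0 < min ε R := lt_min hε hR
  have haR : R < a := by rw [ha]; linarith
  have hYa : ∀ y ∈ Y, ∀ x, dist x y ≤ a → ζ x = 0 := by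
    intro y hy x hx
    apply image_eq_zero_of_notMem_tsupport
    intro hmem
    have := hgap y hy x hmem
    linarith
  have : Nonempty Y := hYne.to_subtype
  obtain ⟨y', hy'⟩ := TopologicalSpace.exists_dense_seq Y
  set y : ℕ → EuclideanSpace ℝ (Fin n) := fun i => (y' i : EuclideanSpace ℝ (Fin n)) with hydef
  have hbound := hardy_dN n hn p hp1 hpn R hR β hβ ζ hζ hζc y a haR
    (fun i x hx => hYa (y i) (y' i).2 x hx)
  have hlim : ∀ x, Filter.Tendsto (fun N => dN y N x) Filter.atTop (nhds (infDist x Y)) := by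
    intro x
    rw [Metric.tendsto_atTop]
    intro η hη
    obtain ⟨z, hz, hxz⟩ := (infDist_lt_iff hYne).1 (lt_add_of_pos_right (infDist x Y) (half_pos hη))
    obtain ⟨k, hk⟩ := hy'.exists_dist_lt ⟨z, hz⟩ (half_pos hη)
    refine ⟨k, fun N hN => ?_⟩
    have h1 : dN y N x ≤ dist x (y k) := Finset.inf'_le _ (by simp; omega)
    have h2 : infDist x Y ≤ dN y N x :=
      Finset.le_inf' _ _ fun i _ => infDist_le_dist_of_mem (y' i).2
    have h3 : dist z (y k) < η / 2 := hk
    have h4 := dist_triangle x z (y k)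
    rw [Real.dist_eq, abs_lt]
    constructor <;> linarith
  have hdd : ∀ x ∈ Ω, infDist x Y ≤ R + infDist x (frontier Ω) := by
    intro x hx
    obtain ⟨ξ, hξ, he⟩ := isClosed_frontier.exists_infDist_eq_dist hfrne x
    obtain ⟨z, hz, hzR⟩ := hext ξ hξ
    have h1 : infDist x Y ≤ dist x z := infDist_le_dist_of_mem hz
    have := dist_triangle x ξ z
    linarith
  have hdiam : ∀ x ∈ Ω, infDist x (frontier Ω) ≤ diam Ω := by
    intro x hx
    obtain ⟨ξ, hξ⟩ := hfrne
    refine (infDist_le_dist_of_mem hξ).trans ?_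
    rw [← diam_closure Ω]
    exact dist_le_diam_of_mem hΩb.closure (subset_closure hx) (frontier_subset_closure hξ)
  have hδpos : ∀ x ∈ Ω, 0 < infDist x (frontier Ω) := by
    intro x hx
    rw [← isClosed_frontier.notMem_iff_infDist_pos hfrne, hΩo.frontier_eq]
    exact fun h => h.2 hx
  have hD0 : 0 ≤ diam Ω := diam_nonneg
  have hq0 : 0 < (R + diam Ω) / R := by positivity
  have hpt : ∀ x ∈ Ω, |ζ x / infDist x (frontier Ω)| ^ p ≤
      ((R + diam Ω) / R) ^ (p * m) * (|ζ x| * hwt R m (infDist x Y)) ^ p := by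
    intro x hx
    by_cases hxs : x ∈ tsupport ζ
    · have hd1 : R < infDist x Y := by
        refine lt_of_lt_of_le haR ?_
        rw [le_infDist hYne]
        intro z hz
        have := hgap z hz x hxs
        linarith
      have hd2 := hdd x hx
      have hδ := hδpos x hx
      have hδ2 := hdiam x hx
      set d := infDist x Y
      set δ := infDist x (frontier Ω)
      have hd0 : 0 < d := hR.trans hd1
      have hw : 1 / δ ≤ ((R + diam Ω) / R) ^ m * hwt R m d := by
        unfold hwt
        have h1 : 0 < d - R := by linarith
        rw [← mul_div_assoc, ← Real.mul_rpow hq0.le (by positivity)]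
        have h2 : 1 ≤ (R + diam Ω) / R * (R / d) := by
          rw [div_mul_div_cancel₀ hR.ne', one_le_div hd0]; linarith
        have h3 : 1 ≤ ((R + diam Ω) / R * (R / d)) ^ m := Real.one_le_rpow h2 hm0.le
        have h4 : d - R ≤ δ := by linarith
        gcongr
      calc |ζ x / δ| ^ p = (|ζ x| * (1 / δ)) ^ p := by
            rw [abs_div, abs_of_pos hδ, mul_one_div]
        _ ≤ (|ζ x| * (((R + diam Ω) / R) ^ m * hwt R m d)) ^ p := by gcongr
        _ = _ := by
            have h5 : 0 ≤ hwt R m d := by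
              unfold hwt
              have h1 : 0 < d - R := by linarith
              positivity
            rw [mul_left_comm, Real.mul_rpow (by positivity) (by positivity),
              ← Real.rpow_mul hq0.le, mul_comm m p]
    · have : ζ x = 0 := image_eq_zero_of_notMem_tsupport hxs
      simp [this, Real.zero_rpow hp0.ne']
  have hdNm : ∀ N, Measurable (dN y N) := by
    intro N
    apply Continuous.measurable
    unfold dN
    exact Continuous.finset_inf'_apply _ fun i _ => by fun_prop
  have hFm : ∀ N, Measurable fun x => ENNReal.ofReal ((|ζ x| * hwt R m (dN y N x)) ^ p) := by
    intro N
    have h1 := measurable_hwt R m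
    have h2 := hζ.continuous.measurable
    have h3 := hdNm N
    fun_prop
  have hFlim : ∀ x, Filter.Tendsto (fun N => ENNReal.ofReal ((|ζ x| * hwt R m (dN y N x)) ^ p))
      Filter.atTop (nhds (ENNReal.ofReal ((|ζ x| * hwt R m (infDist x Y)) ^ p))) := by
    intro x
    by_cases hxs : x ∈ tsupport ζ
    · have hd1 : R < infDist x Y := by
        refine lt_of_lt_of_le haR ?_
        rw [le_infDist hYne]
        intro z hz
        have := hgap z hz x hxs
        linarith
      have hd0 : infDist x Y ≠ 0 := (hR.trans hd1).ne'
      apply ENNReal.tendsto_ofReal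
      apply Filter.Tendsto.rpow_const _ (Or.inr hp0.le)
      apply Filter.Tendsto.const_mul
      unfold hwt
      apply Filter.Tendsto.div
      · exact ((tendsto_const_nhds.div (hlim x) hd0).rpow_const (Or.inr hm0.le))
      · exact (hlim x).sub_const R
      · exact (sub_pos.2 hd1).ne'
    · have : ζ x = 0 := image_eq_zero_of_notMem_tsupport hxs
      simp [this, Real.zero_rpow hp0.ne']
  have hfatou : ∫⁻ x, ENNReal.ofReal ((|ζ x| * hwt R m (infDist x Y)) ^ p) ≤
      ∫⁻ x, ENNReal.ofReal ((p / (p - 1)) ^ p * ‖gradient ζ x‖ ^ p) := by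
    calc _ = ∫⁻ x, Filter.liminf (fun N => ENNReal.ofReal ((|ζ x| * hwt R m (dN y N x)) ^ p))
          Filter.atTop := lintegral_congr fun x => (hFlim x).liminf_eq.symm
      _ ≤ Filter.liminf (fun N => ∫⁻ x, ENNReal.ofReal ((|ζ x| * hwt R m (dN y N x)) ^ p))
          Filter.atTop := lintegral_liminf_le hFm
      _ ≤ Filter.liminf (fun _ : ℕ => ∫⁻ x, ENNReal.ofReal ((p / (p - 1)) ^ p * ‖gradient ζ x‖ ^ p))
          Filter.atTop := Filter.liminf_le_liminf (Filter.Eventually.of_forall hbound)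
      _ = _ := Filter.liminf_const _
  have hgz : ∀ x, x ∉ tsupport ζ → gradient ζ x = 0 := by
    intro x hx
    unfold gradient
    rw [image_eq_zero_of_notMem_tsupport (fun h => hx (tsupport_fderiv_subset ℝ h)), map_zero]
  have hint : Integrable fun x => ‖gradient ζ x‖ ^ p := by
    apply Continuous.integrable_of_hasCompactSupport
    · exact hgc.norm.rpow_const fun x => Or.inr hp0.le
    · refine HasCompactSupport.intro hζc.isCompact fun x hx => ?_
      rw [hgz x hx, norm_zero, Real.zero_rpow hp0.ne']
  have hsetint : ∫ x in Ω, ‖gradient ζ x‖ ^ p = ∫ x, ‖gradient ζ x‖ ^ p := by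
    apply setIntegral_eq_integral_of_forall_compl_eq_zero
    intro x hx
    rw [hgz x (fun h => hx (hζs h)), norm_zero, Real.zero_rpow hp0.ne']
  have hRHS : 0 ≤ ∫ x, ‖gradient ζ x‖ ^ p := integral_nonneg fun x => by positivity
  rw [hsetint, integral_eq_lintegral_of_nonneg_ae (Filter.Eventually.of_forall fun x => by positivity)]
  swap
  · apply Measurable.aestronglyMeasurable
    have h1 := hζ.continuous.measurable
    have h2 : Measurable fun x => infDist x (frontier Ω) := (continuous_infDist_pt _).measurable
    have h3 : Measurable fun x => |ζ x / infDist x (frontier Ω)| := (h1.div h2).abs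
    exact h3.pow_const p
  apply ENNReal.toReal_le_of_le_ofReal (by positivity)
  calc ∫⁻ x in Ω, ENNReal.ofReal (|ζ x / infDist x (frontier Ω)| ^ p)
      ≤ ∫⁻ x in Ω, ENNReal.ofReal (((R + diam Ω) / R) ^ (p * m)) *
          ENNReal.ofReal ((|ζ x| * hwt R m (infDist x Y)) ^ p) := by
        refine setLIntegral_mono' hΩo.measurableSet fun x hx => ?_
        rw [← ENNReal.ofReal_mul (by positivity)]
        exact ENNReal.ofReal_le_ofReal (hpt x hx)
    _ = ENNReal.ofReal (((R + diam Ω) / R) ^ (p * m)) * ∫⁻ x in Ω,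
          ENNReal.ofReal ((|ζ x| * hwt R m (infDist x Y)) ^ p) :=
        lintegral_const_mul' _ _ ENNReal.ofReal_ne_top
    _ ≤ ENNReal.ofReal (((R + diam Ω) / R) ^ (p * m)) * ∫⁻ x,
          ENNReal.ofReal ((|ζ x| * hwt R m (infDist x Y)) ^ p) := by
        gcongr
        exact Measure.restrict_le_self
    _ ≤ ENNReal.ofReal (((R + diam Ω) / R) ^ (p * m)) *
          ∫⁻ x, ENNReal.ofReal ((p / (p - 1)) ^ p * ‖gradient ζ x‖ ^ p) := by gcongr
    _ = ENNReal.ofReal (((R + diam Ω) / R) ^ (p * m)) *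
          ENNReal.ofReal (∫ x, (p / (p - 1)) ^ p * ‖gradient ζ x‖ ^ p) := by
        rw [ofReal_integral_eq_lintegral_ofReal (hint.const_mul _)
          (Filter.Eventually.of_forall fun x => by simp only [Pi.zero_apply]; positivity)]
    _ = _ := by
        rw [integral_const_mul, ← ENNReal.ofReal_mul (by positivity)]
        congr 1; ring
end

section
/- Let a < b be real numbers, let 1 < p < ∞, set δ(x) = min(x − a, b − x) for x ∈ (a, b), and let ζ : ℝ → ℝ be a smooth function with compact support contained in (a, b). Then ∫_a^b |ζ(x)/δ(x)|^p dx ≤ (p/(p−1))^p ∫_a^b |ζ′(x)|^p dx. -/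
open MeasureTheory Set

lemma hardy_pointwise (p : ℝ) (hp : 1 < p) (z w t : ℝ) (ht : 0 < t) :
    |z / t| ^ p - (p / (p - 1)) ^ p * |w| ^ p ≤
      -(p / (p - 1)) * ((p * |z| ^ (p - 2) * z * w) * t ^ (1 - p)
        + |z| ^ p * ((1 - p) * t ^ (1 - p - 1))) := by
  have hp1 : 0 < p - 1 := by linarith
  have hp0 : 0 < p := by linarith
  have hk : 0 < p / (p - 1) := div_pos hp0 hp1
  set k := p / (p - 1) with hkdef
  have hkp : k * (p - 1) = p := by rw [hkdef]; field_simp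
  have hconj : k.HolderConjugate p :=
    ((Real.holderConjugate_iff_eq_conjExponent hp).2 hkdef).symm
  set u := |z| / t with hu
  have hu0 : 0 ≤ u := by positivity
  have habs : |z / t| = u := by rw [abs_div, abs_of_pos ht]
  have e1 : |z| ^ p * t ^ (1 - p - 1) = u ^ p := by
    rw [hu, Real.div_rpow (abs_nonneg z) ht.le, show 1 - p - 1 = -p by ring,
      Real.rpow_neg ht.le]; rfl
  have e2 : |z| ^ (p - 2) * |z| * t ^ (1 - p) = u ^ (p - 1) := by
    rw [hu, Real.div_rpow (abs_nonneg z) ht.le, show 1 - p = -(p - 1) by ring,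
      Real.rpow_neg ht.le, div_eq_mul_inv]
    congr 1
    rcases eq_or_ne z 0 with rfl | hz
    · simp [Real.zero_rpow hp1.ne']
    · rw [← Real.rpow_add_one (abs_pos.2 hz).ne']; congr 1; ring
  have e3 : (p * |z| ^ (p - 2) * z * w) * t ^ (1 - p) ≤ p * (u ^ (p - 1) * |w|) := by
    rw [← e2]
    have h1 : z * w ≤ |z| * |w| := by rw [← abs_mul]; exact le_abs_self _
    have h2 : 0 ≤ p * |z| ^ (p - 2) * t ^ (1 - p) := by positivity
    nlinarith [mul_le_mul_of_nonneg_left h1 h2]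
  have hy := Real.young_inequality_of_nonneg (Real.rpow_nonneg hu0 (p - 1))
    (mul_nonneg hk.le (abs_nonneg w)) hconj
  rw [← Real.rpow_mul hu0, mul_comm (p - 1) k, hkp, Real.mul_rpow hk.le (abs_nonneg w)] at hy
  have hy2 : p * (u ^ (p - 1) * (k * |w|)) ≤ (p - 1) * u ^ p + k ^ p * |w| ^ p := by
    have h := mul_le_mul_of_nonneg_left hy hp0.le
    have : p * (u ^ p / k + k ^ p * |w| ^ p / p) = (p - 1) * u ^ p + k ^ p * |w| ^ p := by
      rw [mul_add, hkdef]; field_simp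
    linarith
  have e4 : |z| ^ p * ((1 - p) * t ^ (1 - p - 1)) = (1 - p) * u ^ p := by rw [← e1]; ring
  rw [habs, e4]
  have h5 := mul_le_mul_of_nonneg_left e3 hk.le
  have h6 : k * ((1 - p) * u ^ p) = - (p * u ^ p) := by
    linear_combination (-(u ^ p)) * hkp
  nlinarith

lemma hardy_half (p : ℝ) (hp : 1 < p) (a c m : ℝ) (hac : a < c) (hcm : c ≤ m)
    (f : ℝ → ℝ) (hf : ContDiff ℝ 1 f) (hfc : f c = 0) :
    ∫ x in c..m, |f x / (x - a)| ^ p ≤ (p / (p - 1)) ^ p * ∫ x in c..m, |deriv f x| ^ p := by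
  have hp1 : 0 < p - 1 := by linarith
  have hp0 : 0 < p := by linarith
  have hk : 0 < p / (p - 1) := div_pos hp0 hp1
  have hdc : Continuous (deriv f) := hf.continuous_deriv le_rfl
  have hfcont := hf.continuous
  have c1 : ContinuousOn (fun x => |f x / (x - a)| ^ p) (Icc c m) := by
    apply ContinuousOn.rpow_const
    · apply ContinuousOn.abs
      apply ContinuousOn.div hfcont.continuousOn (by fun_prop)
      intro x hx
      have := hx.1
      linarith
    · intro x _; right; exact hp0.le
  have c2 : Continuous (fun x => |deriv f x| ^ p) :=
    hdc.abs.rpow_const (fun x => Or.inr hp0.le)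
  have i1 : IntervalIntegrable (fun x => |f x / (x - a)| ^ p) volume c m :=
    ContinuousOn.intervalIntegrable (by rwa [uIcc_of_le hcm])
  have i2 : IntervalIntegrable (fun x => (p / (p - 1)) ^ p * |deriv f x| ^ p) volume c m :=
    (c2.const_mul _).intervalIntegrable _ _
  have key := intervalIntegral.integral_le_sub_of_hasDeriv_right_of_le
    (g := fun x => -(p / (p - 1)) * (|f x| ^ p * (x - a) ^ (1 - p)))
    (g' := fun x => -(p / (p - 1)) * ((p * |f x| ^ (p - 2) * f x * deriv f x) * (x - a) ^ (1 - p)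
        + |f x| ^ p * ((1 - p) * (x - a) ^ (1 - p - 1))))
    (φ := fun x => |f x / (x - a)| ^ p - (p / (p - 1)) ^ p * |deriv f x| ^ p)
    hcm ?_ ?_ ?_ ?_
  · rw [intervalIntegral.integral_sub i1 i2, intervalIntegral.integral_const_mul] at key
    simp only [hfc, abs_zero, Real.zero_rpow hp0.ne', zero_mul, mul_zero, sub_zero] at key
    have : 0 ≤ |f m| ^ p * (m - a) ^ (1 - p) :=
      mul_nonneg (by positivity) (Real.rpow_nonneg (by linarith) _)
    nlinarith
  · apply ContinuousOn.mul continuousOn_const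
    apply ContinuousOn.mul
    · exact (hfcont.abs.rpow_const (fun x => Or.inr hp0.le)).continuousOn
    · apply ContinuousOn.rpow_const (by fun_prop)
      intro x hx; left
      have := hx.1
      linarith
  · intro x hx
    have hx1 := hx.1
    apply HasDerivAt.hasDerivWithinAt
    apply HasDerivAt.const_mul
    have d0 : HasDerivAt f (deriv f x) x := (hf.differentiable one_ne_zero x).hasDerivAt
    have d1 := (hasDerivAt_abs_rpow (f x) hp).comp x d0
    have d2 : HasDerivAt (fun x => (x - a) ^ (1 - p)) ((1 - p) * (x - a) ^ (1 - p - 1)) x := by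
      have := ((hasDerivAt_id x).sub_const a).rpow_const (p := 1 - p)
        (Or.inl (by simp only [id]; linarith))
      simpa using this
    exact d1.mul d2
  · exact (c1.sub (c2.const_mul _).continuousOn).integrableOn_Icc
  · intro x hx
    have hx1 := hx.1
    exact hardy_pointwise p hp (f x) (deriv f x) (x - a) (by linarith)

lemma hardy_half_right (p : ℝ) (hp : 1 < p) (b d m : ℝ) (hdb : d < b) (hmd : m ≤ d)
    (f : ℝ → ℝ) (hf : ContDiff ℝ 1 f) (hfd : f d = 0) :
    ∫ x in m..d, |f x / (b - x)| ^ p ≤ (p / (p - 1)) ^ p * ∫ x in m..d, |deriv f x| ^ p := by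
  have h := hardy_half p hp (-b) (-d) (-m) (by linarith) (by linarith) (fun x => f (-x))
    (hf.comp contDiff_neg) (by simpa using hfd)
  have e1 := intervalIntegral.integral_comp_neg (a := -d) (b := -m)
    (fun x => |f x / (b - x)| ^ p)
  have e2 := intervalIntegral.integral_comp_neg (a := -d) (b := -m)
    (fun x => |deriv f x| ^ p)
  simp only [neg_neg] at e1 e2
  rw [← e1, ← e2]
  have e3 : ∀ x, deriv (fun x => f (-x)) x = - deriv f (-x) := fun x => deriv_comp_neg f x
  simp only [e3, abs_neg] at h
  have e4 : ∀ x : ℝ, x - -b = b - -x := fun x => by ring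
  simpa only [e4] using h

/-- One-dimensional Hardy inequality on an interval `(a, b)` with the sharp
constant `(p/(p-1))^p`, where `δ x = min (x - a) (b - x)` is the distance to
the boundary of the interval. -/
theorem hardy_interval
    (a b : ℝ) (hab : a < b) (p : ℝ) (hp : 1 < p)
    (ζ : ℝ → ℝ) (hζ : ContDiff ℝ (⊤ : ℕ∞) ζ) (hζc : HasCompactSupport ζ)
    (hζs : tsupport ζ ⊆ Set.Ioo a b) :
    ∫ x in Set.Ioo a b, |ζ x / min (x - a) (b - x)| ^ p
      ≤ (p / (p - 1)) ^ p * ∫ x in Set.Ioo a b, |deriv ζ x| ^ p := by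
  have hp0 : p ≠ 0 := by linarith
  have hf : ContDiff ℝ 1 ζ := hζ.of_le (by exact_mod_cast le_top)
  have ho : IsOpen (tsupport ζ)ᶜ := (isClosed_tsupport ζ).isOpen_compl
  obtain ⟨ε₁, hε₁, hb₁⟩ := Metric.isOpen_iff.1 ho a (fun h => lt_irrefl _ (hζs h).1)
  obtain ⟨ε₂, hε₂, hb₂⟩ := Metric.isOpen_iff.1 ho b (fun h => lt_irrefl _ (hζs h).2)
  obtain ⟨η, hη, hη'⟩ := exists_between
    (show 0 < min (min ε₁ ε₂) ((b - a) / 2) from lt_min (lt_min hε₁ hε₂) (by linarith))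
  rw [lt_min_iff, lt_min_iff] at hη'
  obtain ⟨⟨h1, h2⟩, h3⟩ := hη'
  have ns1 : ∀ x, a ≤ x → x ≤ a + η → x ∉ tsupport ζ := fun x hx hx' => hb₁ (by
    rw [Metric.mem_ball, Real.dist_eq, abs_lt]; constructor <;> linarith)
  have ns2 : ∀ x, b - η ≤ x → x ≤ b → x ∉ tsupport ζ := fun x hx hx' => hb₂ (by
    rw [Metric.mem_ball, Real.dist_eq, abs_lt]; constructor <;> linarith)
  set c := a + η with hc
  set d := b - η with hd
  set m := (a + b) / 2 with hm
  have hac : a < c := by linarith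
  have hcm : c ≤ m := by linarith
  have hmd : m ≤ d := by linarith
  have hdb : d < b := by linarith
  have z0 : ∀ x, x ∉ tsupport ζ → ζ x = 0 := fun x hx => image_eq_zero_of_notMem_tsupport hx
  have z1 : ∀ x, x ∉ tsupport ζ → deriv ζ x = 0 := fun x hx => by
    by_contra h
    exact hx (support_deriv_subset h)
  have red : ∀ F : ℝ → ℝ, (∀ x, x ∉ tsupport ζ → F x = 0) →
      ∫ x in Ioo a b, F x = ∫ x in c..d, F x := by
    intro F hF
    rw [intervalIntegral.integral_of_le (hcm.trans hmd)]
    apply setIntegral_eq_of_subset_of_forall_sdiff_eq_zero measurableSet_Ioo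
    · intro x hx
      exact ⟨hac.trans hx.1, hx.2.trans_lt hdb⟩
    · rintro x ⟨hx, hx'⟩
      apply hF
      by_cases hxc : x ≤ c
      · exact ns1 x hx.1.le hxc
      · apply ns2 x _ hx.2.le
        by_contra hxd
        exact hx' ⟨not_le.1 hxc, (not_le.1 hxd).le⟩
  rw [red _ (fun x hx => by simp [z0 x hx, Real.zero_rpow hp0]),
    red _ (fun x hx => by simp [z1 x hx, Real.zero_rpow hp0])]
  have c2 : Continuous (fun x => |deriv ζ x| ^ p) :=
    (hf.continuous_deriv le_rfl).abs.rpow_const (fun x => Or.inr (by linarith))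
  have c1 : ContinuousOn (fun x => |ζ x / min (x - a) (b - x)| ^ p) (Icc c d) := by
    apply ContinuousOn.rpow_const
    · apply ContinuousOn.abs
      apply ContinuousOn.div hf.continuous.continuousOn (by fun_prop)
      intro x hx
      have := hx.1
      have := hx.2
      exact (lt_min (by linarith) (by linarith)).ne'
    · intro x _; right; linarith
  have i1 : IntervalIntegrable (fun x => |ζ x / min (x - a) (b - x)| ^ p) volume c m := by
    apply ContinuousOn.intervalIntegrable
    rw [uIcc_of_le hcm]
    exact c1.mono (Icc_subset_Icc_right hmd)
  have i2 : IntervalIntegrable (fun x => |ζ x / min (x - a) (b - x)| ^ p) volume m d := by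
    apply ContinuousOn.intervalIntegrable
    rw [uIcc_of_le hmd]
    exact c1.mono (Icc_subset_Icc_left hcm)
  rw [← intervalIntegral.integral_add_adjacent_intervals i1 i2,
    ← intervalIntegral.integral_add_adjacent_intervals (c2.intervalIntegrable c m)
      (c2.intervalIntegrable m d), mul_add]
  have L := hardy_half p hp a c m hac hcm ζ hf (z0 _ (ns1 c hac.le le_rfl))
  have R := hardy_half_right p hp b d m hdb hmd ζ hf (z0 _ (ns2 d le_rfl hdb.le))
  refine add_le_add (le_trans (le_of_eq ?_) L) (le_trans (le_of_eq ?_) R)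
  · apply intervalIntegral.integral_congr
    intro x hx
    rw [uIcc_of_le hcm] at hx
    have := hx.2
    simp only
    rw [min_eq_left (by linarith)]
  · apply intervalIntegral.integral_congr
    intro x hx
    rw [uIcc_of_le hmd] at hx
    have := hx.1
    simp only
    rw [min_eq_right (by linarith)]
end
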